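/- arXiv:0709.0549 — 8 statements merged into one kernel-verified Lean document; each statement's English description precedes it below -/
import Mathlib

section
/- For every a = (a₁,a₂,a₃,a₄) ∈ ℂ⁴ and every v = (v₁,v₂,v₃) ∈ ℂ³ with f(a,v) = 0, the image τ₁(v) also satisfies f(a, τ₁(v)) = 0; that is, the braid-group generator τ₁ maps the relative character variety M_a = {v ∈ ℂ³ : f(a,v) = 0} into itself. -/
/-- The Fricke-type polynomial cutting out the relative character variety. -/
def fpoly (a1 a2 a3 a4 : ℂ) (v : ℂ × ℂ × ℂ) : ℂ :=
  v.1 ^ 2 + v.2.1 ^ 2 + v.2.2 ^ 2 + v.1 * v.2.1 * v.2.2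
    - (a1 * a2 + a3 * a4) * v.1 - (a1 * a4 + a2 * a3) * v.2.1
    - (a1 * a3 + a2 * a4) * v.2.2
    + (a1 ^ 2 + a2 ^ 2 + a3 ^ 2 + a4 ^ 2 + a1 * a2 * a3 * a4 - 4)

/-- The braid group generator τ₁ acting on trace coordinates. -/
def tau1 (a1 a2 a3 a4 : ℂ) (v : ℂ × ℂ × ℂ) : ℂ × ℂ × ℂ :=
  (v.1,
   a1 * a4 + a2 * a3 - v.1 * (a1 * a3 + a2 * a4 - v.1 * v.2.1 - v.2.2) - v.2.1,
   a1 * a3 + a2 * a4 - v.1 * v.2.1 - v.2.2)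

/-- The braid group generator τ₂ acting on trace coordinates. -/
def tau2 (a1 a2 a3 a4 : ℂ) (v : ℂ × ℂ × ℂ) : ℂ × ℂ × ℂ :=
  (a1 * a2 + a3 * a4 - v.2.1 * v.2.2 - v.1,
   v.2.1,
   a2 * a4 + a1 * a3 - v.2.1 * (a1 * a2 + a3 * a4 - v.2.1 * v.2.2 - v.1) - v.2.2)

/-- The braid group generator τ₃ acting on trace coordinates. -/
def tau3 (a1 a2 a3 a4 : ℂ) (v : ℂ × ℂ × ℂ) : ℂ × ℂ × ℂ :=
  (a1 * a2 + a3 * a4 - v.2.2 * (a2 * a3 + a1 * a4 - v.2.2 * v.1 - v.2.1) - v.1,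
   a2 * a3 + a1 * a4 - v.2.2 * v.1 - v.2.1,
   v.2.2)

/-- The polynomial `fpoly` is invariant under `tau1`, a composition of two Vieta involutions. -/
theorem fpoly_tau1 (a1 a2 a3 a4 : ℂ) (v : ℂ × ℂ × ℂ) :
    fpoly a1 a2 a3 a4 (tau1 a1 a2 a3 a4 v) = fpoly a1 a2 a3 a4 v := by
  simp only [fpoly, tau1]
  ring

/-- The braid generator τ1 maps the relative character variety
`M_a = {v : fpoly a v = 0}` into itself. -/
theorem tau (a1 a2 a3 a4 : ℂ) (v : ℂ × ℂ × ℂ)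
    (h : fpoly a1 a2 a3 a4 v = 0) :
    fpoly a1 a2 a3 a4 (tau1 a1 a2 a3 a4 v) = 0 := by
  rw [fpoly_tau1, h]
end

section
/- If A = (A₁,A₂,A₃,A₄) is a quadruple of matrices in SL(2,ℂ) with A₁A₂A₃A₄ = I, then its trace coordinates a = (tr A₁, tr A₂, tr A₃, tr A₄) and v = (tr(A₁A₂), tr(A₂A₃), tr(A₁A₃)) satisfy the polynomial relation f(a,v) = 0. -/
open Matrix

namespace Matrix

variable {R : Type*} [CommRing R]

/-- The polarized Cayley–Hamilton identity for the sum of the two triple traces. -/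
theorem trace_mul_mul_add_trace_mul_mul_fin_two (A B C : Matrix (Fin 2) (Fin 2) R) :
    (A * B * C).trace + (A * C * B).trace =
      A.trace * (B * C).trace + B.trace * (A * C).trace + C.trace * (A * B).trace
        - A.trace * B.trace * C.trace := by
  simp only [trace_fin_two, mul_apply, Fin.sum_univ_two]
  ring

/-- Fricke's identity for the product of the two triple traces. -/
theorem trace_mul_mul_mul_trace_mul_mul_fin_two (A B C : Matrix (Fin 2) (Fin 2) R) :
    (A * B * C).trace * (A * C * B).trace =
      A.trace ^ 2 * B.det * C.det + B.trace ^ 2 * A.det * C.det + C.trace ^ 2 * A.det * B.det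
        + (A * B).trace ^ 2 * C.det + (B * C).trace ^ 2 * A.det + (A * C).trace ^ 2 * B.det
        - A.trace * B.trace * (A * B).trace * C.det
        - B.trace * C.trace * (B * C).trace * A.det
        - A.trace * C.trace * (A * C).trace * B.det
        + (A * B).trace * (B * C).trace * (A * C).trace - 4 * A.det * B.det * C.det := by
  simp only [trace_fin_two, det_fin_two, mul_apply, Fin.sum_univ_two]
  ring

theorem trace_adjugate_fin_two (A : Matrix (Fin 2) (Fin 2) R) :
    A.adjugate.trace = A.trace := by
  simp [adjugate_fin_two, trace_fin_two, add_comm]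

theorem trace_eq_of_mul_eq_one_fin_two {A B : Matrix (Fin 2) (Fin 2) R}
    (hA : A.det = 1) (h : A * B = 1) : B.trace = A.trace := by
  have hB : B = A.adjugate := by
    calc B = A.adjugate * A * B := by rw [adjugate_mul, hA, one_smul, one_mul]
      _ = A.adjugate := by rw [mul_assoc, h, mul_one]
  rw [hB, trace_adjugate_fin_two]

end Matrix

/-- The trace coordinates of a quadruple in SL(2,ℂ) with product the identity
satisfy the polynomial relation `f(a,v) = 0`. -/
theorem trace_coordinates_satisfy_fpoly
    (A1 A2 A3 A4 : Matrix (Fin 2) (Fin 2) ℂ)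
    (h1 : A1.det = 1) (h2 : A2.det = 1) (h3 : A3.det = 1) (h4 : A4.det = 1)
    (hprod : A1 * A2 * A3 * A4 = 1) :
    fpoly A1.trace A2.trace A3.trace A4.trace
      ((A1 * A2).trace, (A2 * A3).trace, (A1 * A3).trace) = 0 := by
  have hdet : (A1 * A2 * A3).det = 1 := by simp [h1, h2, h3]
  have hsum := trace_mul_mul_add_trace_mul_mul_fin_two A1 A2 A3
  have hmul := trace_mul_mul_mul_trace_mul_mul_fin_two A1 A2 A3
  rw [h1, h2, h3] at hmul
  rw [trace_eq_of_mul_eq_one_fin_two hdet hprod, fpoly]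
  linear_combination (A1 * A2 * A3).trace * hsum - hmul
end

section
/- For every a = (a₁,a₂,a₃,a₄) ∈ ℂ⁴ and v = (v₁,v₂,v₃) ∈ ℂ³ with f(a,v) = 0, there exists a quadruple A = (A₁,A₂,A₃,A₄) of matrices in SL(2,ℂ) with A₁A₂A₃A₄ = I whose trace coordinates are exactly (a,v), i.e. tr Aᵢ = aᵢ for i = 1,…,4 and (tr(A₁A₂), tr(A₂A₃), tr(A₁A₃)) = (v₁,v₂,v₃). -/
open Matrix

/-- A complex symmetric bilinear form on a finite-dimensional space is the pullback of the standard
dot product on `ℂ ^ dim V`. -/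
theorem exists_dotProduct_eq_of_isSymm {V : Type*} [AddCommGroup V] [Module ℂ V]
    [FiniteDimensional ℂ V] (B : LinearMap.BilinForm ℂ V) (hB : B.IsSymm) :
    ∃ m : V → Fin (Module.finrank ℂ V) → ℂ, ∀ x y, m x ⬝ᵥ m y = B x y := by
  obtain ⟨b, hb⟩ := LinearMap.BilinForm.exists_orthogonal_basis (LinearMap.BilinForm.isSymm_iff.1 hB)
  choose s hs using fun k => IsAlgClosed.exists_pow_nat_eq (B (b k) (b k)) two_pos
  refine ⟨fun x k => b.repr x k * s k, fun x y => ?_⟩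
  conv_rhs => rw [← b.sum_repr x, ← b.sum_repr y]
  simp only [dotProduct, map_sum, map_smul, LinearMap.sum_apply, LinearMap.smul_apply,
    smul_eq_mul]
  refine Finset.sum_congr rfl fun k _ => ?_
  rw [Finset.sum_eq_single k]
  · rw [← hs k]
    ring
  · intro j _ hj
    rw [show B (b j) (b k) = 0 from hb hj]
    simp
  · simp

/-- Every complex symmetric matrix is the Gram matrix of a family of vectors for the dot product. -/
theorem Matrix.IsSymm.exists_eq_mul_transpose {n : ℕ} {G : Matrix (Fin n) (Fin n) ℂ}
    (hG : G.IsSymm) : ∃ M : Matrix (Fin n) (Fin n) ℂ, M * Mᵀ = G := by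
  obtain ⟨m, hm⟩ :=
    exists_dotProduct_eq_of_isSymm (Matrix.toBilin' G) (Matrix.isSymm_toBilin'_iff_isSymm.2 hG)
  let e := finCongr (Module.finrank_fin_fun (n := n) ℂ)
  refine ⟨Matrix.of fun i k => m (Pi.single i 1) (e.symm k), ?_⟩
  ext i j
  rw [← Matrix.toBilin'_single G i j, ← hm, Matrix.mul_apply]
  exact Equiv.sum_comp e.symm fun k => m (Pi.single i 1) k * m (Pi.single j 1) k

/-- The matrix of trace `a` whose traceless part is the combination of the Pauli matrices with
coefficients `u`. -/
noncomputable def pauliMatrix (a : ℂ) (u : Fin 3 → ℂ) : Matrix (Fin 2) (Fin 2) ℂ :=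
  !![a / 2 + u 0, u 1 + Complex.I * u 2; u 1 - Complex.I * u 2, a / 2 - u 0]

theorem trace_pauliMatrix (a : ℂ) (u : Fin 3 → ℂ) : (pauliMatrix a u).trace = a := by
  simp [pauliMatrix, Matrix.trace_fin_two]

theorem det_pauliMatrix (a : ℂ) (u : Fin 3 → ℂ) :
    (pauliMatrix a u).det = a ^ 2 / 4 - u ⬝ᵥ u := by
  simp only [pauliMatrix, Matrix.det_fin_two_of, dotProduct, Fin.sum_univ_three]
  linear_combination (u 2) ^ 2 * Complex.I_sq

theorem trace_pauliMatrix_mul (a b : ℂ) (u w : Fin 3 → ℂ) :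
    (pauliMatrix a u * pauliMatrix b w).trace = a * b / 2 + 2 * (u ⬝ᵥ w) := by
  simp only [pauliMatrix, Matrix.mul_fin_two, Matrix.trace_fin_two_of, dotProduct,
    Fin.sum_univ_three]
  linear_combination (-2 * u 2 * w 2) * Complex.I_sq

theorem trace_pauliMatrix_mul_mul (a b c : ℂ) (M : Matrix (Fin 3) (Fin 3) ℂ) :
    (pauliMatrix a (M 0) * pauliMatrix b (M 1) * pauliMatrix c (M 2)).trace =
      a * b * c / 4 + a * (M 1 ⬝ᵥ M 2) + b * (M 0 ⬝ᵥ M 2) + c * (M 0 ⬝ᵥ M 1)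
        - 2 * Complex.I * M.det := by
  simp only [pauliMatrix, Matrix.mul_fin_two, Matrix.trace_fin_two_of, dotProduct,
    Fin.sum_univ_three, Matrix.det_fin_three]
  linear_combination (-a * M 1 2 * M 2 2 - b * M 0 2 * M 2 2 - c * M 0 2 * M 1 2) * Complex.I_sq

/-- Any six complex numbers are the traces of three matrices in `SL(2,ℂ)` and of their pairwise
products; moreover any root `d` of the Fricke polynomial is the trace of the triple product for a
suitable choice of the three matrices. -/
theorem exists_triple_with_traces (a b c d x y z : ℂ) (h : fpoly a b c d (x, y, z) = 0) :
    ∃ A B C : Matrix (Fin 2) (Fin 2) ℂ,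
      A.det = 1 ∧ B.det = 1 ∧ C.det = 1 ∧ A.trace = a ∧ B.trace = b ∧ C.trace = c ∧
      (A * B).trace = x ∧ (B * C).trace = y ∧ (A * C).trace = z ∧ (A * B * C).trace = d := by
  let G : Matrix (Fin 3) (Fin 3) ℂ :=
    !![a ^ 2 / 4 - 1, x / 2 - a * b / 4, z / 2 - a * c / 4;
      x / 2 - a * b / 4, b ^ 2 / 4 - 1, y / 2 - b * c / 4;
      z / 2 - a * c / 4, y / 2 - b * c / 4, c ^ 2 / 4 - 1]
  have hG : G.IsSymm := by
    ext i j
    fin_cases i <;> fin_cases j <;> rfl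
  obtain ⟨M, hM⟩ := hG.exists_eq_mul_transpose
  have key (N : Matrix (Fin 3) (Fin 3) ℂ) (hN : N * Nᵀ = G)
      (hd : d = a * b * c / 4 + a * (y / 2 - b * c / 4) + b * (z / 2 - a * c / 4)
        + c * (x / 2 - a * b / 4) - 2 * Complex.I * N.det) :
      ∃ A B C : Matrix (Fin 2) (Fin 2) ℂ,
        A.det = 1 ∧ B.det = 1 ∧ C.det = 1 ∧ A.trace = a ∧ B.trace = b ∧ C.trace = c ∧
        (A * B).trace = x ∧ (B * C).trace = y ∧ (A * C).trace = z ∧ (A * B * C).trace = d := by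
    have hdot (i j : Fin 3) : N i ⬝ᵥ N j = G i j := congrFun (congrFun hN i) j
    refine ⟨pauliMatrix a (N 0), pauliMatrix b (N 1), pauliMatrix c (N 2), ?_, ?_, ?_,
      trace_pauliMatrix _ _, trace_pauliMatrix _ _, trace_pauliMatrix _ _, ?_, ?_, ?_, ?_⟩ <;>
    simp only [det_pauliMatrix, trace_pauliMatrix_mul, trace_pauliMatrix_mul_mul, hdot, hd] <;>
    simp [G] <;> ring
  have hdet : M.det ^ 2 = G.det := by
    rw [← hM, Matrix.det_mul, Matrix.det_transpose, sq]
  have hprod : (d - (a * b * c / 4 + a * (y / 2 - b * c / 4) + b * (z / 2 - a * c / 4)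
        + c * (x / 2 - a * b / 4) - 2 * Complex.I * M.det)) *
      (d - (a * b * c / 4 + a * (y / 2 - b * c / 4) + b * (z / 2 - a * c / 4)
        + c * (x / 2 - a * b / 4) - 2 * Complex.I * (-M).det)) = 0 := by
    rw [Matrix.det_neg]
    have hdetG := Matrix.det_fin_three G
    simp [G] at hdetG
    rw [← hdet] at hdetG
    simp only [fpoly] at h
    simp only [Fintype.card_fin]
    linear_combination h + 4 * hdetG - 4 * M.det ^ 2 * Complex.I_sq
  rcases mul_eq_zero.1 hprod with h1 | h1
  · exact key M hM (sub_eq_zero.1 h1)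
  · exact key (-M) (by rw [Matrix.transpose_neg, neg_mul_neg, hM]) (sub_eq_zero.1 h1)

/-- Every point of the relative character variety `{(a,v) : f(a,v) = 0}` is
realized by a quadruple in SL(2,ℂ) with product the identity. -/
theorem exists_representation_with_trace_coordinates
    (a1 a2 a3 a4 v1 v2 v3 : ℂ) (h : fpoly a1 a2 a3 a4 (v1, v2, v3) = 0) :
    ∃ A1 A2 A3 A4 : Matrix (Fin 2) (Fin 2) ℂ,
      A1.det = 1 ∧ A2.det = 1 ∧ A3.det = 1 ∧ A4.det = 1 ∧
      A1 * A2 * A3 * A4 = 1 ∧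
      A1.trace = a1 ∧ A2.trace = a2 ∧ A3.trace = a3 ∧ A4.trace = a4 ∧
      (A1 * A2).trace = v1 ∧ (A2 * A3).trace = v2 ∧ (A1 * A3).trace = v3 := by
  obtain ⟨A, B, C, hA, hB, hC, tA, tB, tC, tAB, tBC, tAC, tABC⟩ :=
    exists_triple_with_traces a1 a2 a3 a4 v1 v2 v3 h
  have hdet : (A * B * C).det = 1 := by simp [hA, hB, hC]
  refine ⟨A, B, C, (A * B * C).adjugate, hA, hB, hC, ?_, ?_, tA, tB, tC, ?_, tAB, tBC, tAC⟩
  · simp [Matrix.det_adjugate, hdet]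
  · rw [Matrix.mul_adjugate, hdet, one_smul]
  · rw [← tABC, Matrix.trace_fin_two, Matrix.adjugate_fin_two, Matrix.trace_fin_two]
    simp [add_comm]
end

section
/- Let A = (A₁,A₂,A₃,A₄) be a quadruple of matrices in SL(2,ℂ) with A₁A₂A₃A₄ = I which is irreducible (the matrices A₁,…,A₄ have no common eigenvector in ℂ²). If all seven trace coordinates tr A₁, tr A₂, tr A₃, tr A₄, tr(A₁A₂), tr(A₂A₃), tr(A₁A₃) are real, then A is an SU(2)-class or an SL(2,ℝ)-class. -/
open Matrix

/-- A quadruple of 2×2 complex matrices is an SU(2)-class if some single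
`g ∈ GL(2,ℂ)` conjugates all four of them into SU(2). -/
def IsSU2Class (A1 A2 A3 A4 : Matrix (Fin 2) (Fin 2) ℂ) : Prop :=
  ∃ g : GL (Fin 2) ℂ, ∀ B ∈ ({A1, A2, A3, A4} : Set (Matrix (Fin 2) (Fin 2) ℂ)),
    ((g : Matrix (Fin 2) (Fin 2) ℂ) * B * ((g⁻¹ : GL (Fin 2) ℂ) : Matrix (Fin 2) (Fin 2) ℂ))
      ∈ Matrix.unitaryGroup (Fin 2) ℂ ∧
    ((g : Matrix (Fin 2) (Fin 2) ℂ) * B * ((g⁻¹ : GL (Fin 2) ℂ) : Matrix (Fin 2) (Fin 2) ℂ)).det = 1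

/-- A quadruple of 2×2 complex matrices is an SL(2,ℝ)-class if some single
`g ∈ GL(2,ℂ)` conjugates all four of them into matrices with real entries. -/
def IsSL2RClass (A1 A2 A3 A4 : Matrix (Fin 2) (Fin 2) ℂ) : Prop :=
  ∃ g : GL (Fin 2) ℂ, ∀ B ∈ ({A1, A2, A3, A4} : Set (Matrix (Fin 2) (Fin 2) ℂ)),
    ∀ i j, (((g : Matrix (Fin 2) (Fin 2) ℂ) * B *
      ((g⁻¹ : GL (Fin 2) ℂ) : Matrix (Fin 2) (Fin 2) ℂ)) i j).im = 0

/-- An irreducible family of matrices in `SL(2,ℂ)` all of whose traces of words of length at most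
three are real. -/
structure IrreducibleWithRealTraces {ι : Type*} (A : ι → Matrix (Fin 2) (Fin 2) ℂ) : Prop where
  det_eq_one : ∀ i, (A i).det = 1
  trace_im : ∀ i, (A i).trace.im = 0
  trace_mul_im : ∀ i j, (A i * A j).trace.im = 0
  trace_mul_mul_im : ∀ i j k, (A i * A j * A k).trace.im = 0
  irreducible : ¬∃ w : Fin 2 → ℂ, w ≠ 0 ∧ ∀ i, ∃ c : ℂ, (A i).mulVec w = c • w

/-- Some matrix in `GL(2,ℂ)` conjugates every member of the family into the set `s`. -/
def IsConjugateInto {ι : Type*} (A : ι → Matrix (Fin 2) (Fin 2) ℂ)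
    (s : Set (Matrix (Fin 2) (Fin 2) ℂ)) : Prop :=
  ∃ P Q : Matrix (Fin 2) (Fin 2) ℂ, P * Q = 1 ∧ ∀ i, P * A i * Q ∈ s

/-- The complex `2 × 2` matrices with real entries. -/
def realEntries : Set (Matrix (Fin 2) (Fin 2) ℂ) := {B | ∀ i j, (B i j).im = 0}

section Conjugation

variable {ι : Type*} {A : ι → Matrix (Fin 2) (Fin 2) ℂ} {P Q : Matrix (Fin 2) (Fin 2) ℂ}

theorem conj_mul_conj (hQP : Q * P = 1) (X Y : Matrix (Fin 2) (Fin 2) ℂ) :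
    P * X * Q * (P * Y * Q) = P * (X * Y) * Q := by
  calc P * X * Q * (P * Y * Q) = P * X * (Q * P) * Y * Q := by simp only [Matrix.mul_assoc]
    _ = P * (X * Y) * Q := by rw [hQP]; simp only [Matrix.mul_one, Matrix.mul_assoc]

theorem trace_conj_eq (hQP : Q * P = 1) (X : Matrix (Fin 2) (Fin 2) ℂ) :
    (P * X * Q).trace = X.trace := by
  rw [Matrix.trace_mul_comm, ← Matrix.mul_assoc, hQP, Matrix.one_mul]

theorem det_conj_eq (hQP : Q * P = 1) (X : Matrix (Fin 2) (Fin 2) ℂ) :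
    (P * X * Q).det = X.det := by
  rw [Matrix.det_mul_comm, ← Matrix.mul_assoc, hQP, Matrix.one_mul]

theorem IrreducibleWithRealTraces.conj (h : IrreducibleWithRealTraces A) (hPQ : P * Q = 1) :
    IrreducibleWithRealTraces fun i => P * A i * Q := by
  have hQP : Q * P = 1 := mul_eq_one_comm.mp hPQ
  refine ⟨fun i => ?_, fun i => ?_, fun i j => ?_, fun i j k => ?_, ?_⟩
  · rw [det_conj_eq hQP, h.det_eq_one]
  · rw [trace_conj_eq hQP, h.trace_im]
  · rw [conj_mul_conj hQP, trace_conj_eq hQP, h.trace_mul_im]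
  · rw [conj_mul_conj hQP, conj_mul_conj hQP, trace_conj_eq hQP, h.trace_mul_mul_im]
  · rintro ⟨w, hw, hc⟩
    refine h.irreducible ⟨Q.mulVec w, fun h0 => hw ?_, fun i => ?_⟩
    · rw [← Matrix.one_mulVec w, ← hPQ, ← Matrix.mulVec_mulVec, h0, Matrix.mulVec_zero]
    · obtain ⟨c, hc⟩ := hc i
      refine ⟨c, ?_⟩
      rw [← Matrix.mulVec_smul, ← hc, Matrix.mulVec_mulVec, Matrix.mulVec_mulVec,
        ← Matrix.mul_assoc, ← Matrix.mul_assoc, hQP, Matrix.one_mul]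

theorem IsConjugateInto.of_conj {s : Set (Matrix (Fin 2) (Fin 2) ℂ)} (hPQ : P * Q = 1)
    (h : IsConjugateInto (fun i => P * A i * Q) s) : IsConjugateInto A s := by
  obtain ⟨P', Q', h1, h2⟩ := h
  refine ⟨P' * P, Q * Q', ?_, fun i => ?_⟩
  · rw [Matrix.mul_assoc, ← Matrix.mul_assoc P, hPQ, Matrix.one_mul, h1]
  · simpa only [Matrix.mul_assoc] using h2 i

end Conjugation

theorem trace_mul_self_mul (X Y : Matrix (Fin 2) (Fin 2) ℂ) :
    (X * X * Y).trace = X.trace * (X * Y).trace - X.det * Y.trace := by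
  simp only [Matrix.trace_fin_two, Matrix.det_fin_two, Matrix.mul_apply, Fin.sum_univ_two]
  ring

theorem trace_mul_mul_swap (X Y Z : Matrix (Fin 2) (Fin 2) ℂ) :
    (X * Z * Y).trace = X.trace * (Y * Z).trace + Y.trace * (X * Z).trace
      + Z.trace * (X * Y).trace - X.trace * Y.trace * Z.trace - (X * Y * Z).trace := by
  simp only [Matrix.trace_fin_two, Matrix.mul_apply, Fin.sum_univ_two]
  ring

/-- The traces of all words of length three are real once the Fricke coordinates are. -/
theorem trace_mul_mul_im_eq_zero {A : Fin 3 → Matrix (Fin 2) (Fin 2) ℂ}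
    (hdet : ∀ i, (A i).det = 1) (h1 : ∀ i, (A i).trace.im = 0)
    (h2 : ∀ i j, (A i * A j).trace.im = 0) (h3 : (A 0 * A 1 * A 2).trace.im = 0)
    (i j k : Fin 3) : (A i * A j * A k).trace.im = 0 := by
  have hsq : ∀ i k, (A i * A i * A k).trace.im = 0 := fun i k => by
    simp [trace_mul_self_mul, hdet, h1, h2]
  have hcyc : ∀ i j k, (A i * A j * A k).trace = (A j * A k * A i).trace := fun i j k => by
    rw [Matrix.mul_assoc, Matrix.trace_mul_comm]
  have hswap : (A 0 * A 2 * A 1).trace.im = 0 := by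
    simp [trace_mul_mul_swap (A 0) (A 1) (A 2), h1, h2, h3]
  by_cases hij : i = j
  · subst hij; exact hsq i k
  by_cases hjk : j = k
  · subst hjk; rw [hcyc]; exact hsq j i
  by_cases hik : i = k
  · subst hik; rw [← hcyc]; exact hsq i j
  have hperm : ∀ i j k : Fin 3, i ≠ j → j ≠ k → i ≠ k →
      (i = 0 ∧ j = 1 ∧ k = 2) ∨ (i = 1 ∧ j = 2 ∧ k = 0) ∨ (i = 2 ∧ j = 0 ∧ k = 1) ∨
      (i = 0 ∧ j = 2 ∧ k = 1) ∨ (i = 2 ∧ j = 1 ∧ k = 0) ∨ (i = 1 ∧ j = 0 ∧ k = 2) := by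
    decide
  rcases hperm i j k hij hjk hik with ⟨rfl, rfl, rfl⟩ | ⟨rfl, rfl, rfl⟩ |
    ⟨rfl, rfl, rfl⟩ | ⟨rfl, rfl, rfl⟩ |
    ⟨rfl, rfl, rfl⟩ | ⟨rfl, rfl, rfl⟩
  · exact h3
  · rwa [← hcyc]
  · rwa [hcyc]
  · exact hswap
  · rwa [← hcyc]
  · rwa [hcyc]

/-- A linear factorisation `(X - a) (X - b)` of the characteristic polynomial of a nonscalar
matrix with `a ≠ b` diagonalises it. -/
theorem exists_conj_eq_diagonal {K : Matrix (Fin 2) (Fin 2) ℂ} {u v a b : ℂ}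
    (huv : u * (K 1 0 * u + K 1 1 * v) - v * (K 0 0 * u + K 0 1 * v) ≠ 0)
    (htr : K.trace = a + b) (hdet : K.det = a * b) (hab : a ≠ b) :
    ∃ P Q : Matrix (Fin 2) (Fin 2) ℂ, P * Q = 1 ∧ P * K * Q = !![a, 0; 0, b] := by
  set Q : Matrix (Fin 2) (Fin 2) ℂ :=
    !![K 0 0 * u + K 0 1 * v - b * u, K 0 0 * u + K 0 1 * v - a * u;
      K 1 0 * u + K 1 1 * v - b * v, K 1 0 * u + K 1 1 * v - a * v] with hQ
  have hQdet : IsUnit Q.det := by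
    rw [isUnit_iff_ne_zero]
    have : Q.det = (a - b) *
        (u * (K 1 0 * u + K 1 1 * v) - v * (K 0 0 * u + K 0 1 * v)) := by
      rw [Matrix.det_fin_two_of]; ring
    rw [this]
    exact mul_ne_zero (sub_ne_zero.mpr hab) huv
  refine ⟨Q⁻¹, Q, Matrix.nonsing_inv_mul Q hQdet, ?_⟩
  have hKQ : K * Q = Q * !![a, 0; 0, b] := by
    rw [Matrix.trace_fin_two] at htr
    rw [Matrix.det_fin_two] at hdet
    ext r s
    fin_cases r <;> fin_cases s <;> simp [hQ, Matrix.mul_apply, Fin.sum_univ_two]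
    · linear_combination (K 0 0 * u + K 0 1 * v) * htr - u * hdet
    · linear_combination (K 0 0 * u + K 0 1 * v) * htr - u * hdet
    · linear_combination (K 1 0 * u + K 1 1 * v) * htr - v * hdet
    · linear_combination (K 1 0 * u + K 1 1 * v) * htr - v * hdet
  rw [Matrix.mul_assoc, hKQ, ← Matrix.mul_assoc, Matrix.nonsing_inv_mul Q hQdet, Matrix.one_mul]

/-- A nonscalar matrix with a double eigenvalue is conjugate to a Jordan block. -/
theorem exists_conj_eq_jordan {K : Matrix (Fin 2) (Fin 2) ℂ} {u v a : ℂ}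
    (huv : u * (K 1 0 * u + K 1 1 * v) - v * (K 0 0 * u + K 0 1 * v) ≠ 0)
    (htr : K.trace = a + a) (hdet : K.det = a * a) :
    ∃ P Q : Matrix (Fin 2) (Fin 2) ℂ, P * Q = 1 ∧ P * K * Q = !![a, 1; 0, a] := by
  set Q : Matrix (Fin 2) (Fin 2) ℂ :=
    !![K 0 0 * u + K 0 1 * v - a * u, u; K 1 0 * u + K 1 1 * v - a * v, v] with hQ
  have hQdet : IsUnit Q.det := by
    rw [isUnit_iff_ne_zero]
    have : Q.det = -(u * (K 1 0 * u + K 1 1 * v) - v * (K 0 0 * u + K 0 1 * v)) := by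
      rw [Matrix.det_fin_two_of]; ring
    rw [this]
    exact neg_ne_zero.mpr huv
  refine ⟨Q⁻¹, Q, Matrix.nonsing_inv_mul Q hQdet, ?_⟩
  have hKQ : K * Q = Q * !![a, 1; 0, a] := by
    rw [Matrix.trace_fin_two] at htr
    rw [Matrix.det_fin_two] at hdet
    ext r s
    fin_cases r <;> fin_cases s <;> simp [hQ, Matrix.mul_apply, Fin.sum_univ_two]
    · linear_combination (K 0 0 * u + K 0 1 * v) * htr - u * hdet
    · ring
    · linear_combination (K 1 0 * u + K 1 1 * v) * htr - v * hdet
    · ring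
  rw [Matrix.mul_assoc, hKQ, ← Matrix.mul_assoc, Matrix.nonsing_inv_mul Q hQdet, Matrix.one_mul]

namespace IrreducibleWithRealTraces

variable {ι : Type*} {A : ι → Matrix (Fin 2) (Fin 2) ℂ}

theorem exists_lower_ne_zero (h : IrreducibleWithRealTraces A) : ∃ i, A i 1 0 ≠ 0 := by
  by_contra! h0
  refine h.irreducible ⟨![1, 0], fun hw => by simpa using congrFun hw 0, fun i => ⟨A i 0 0, ?_⟩⟩
  ext j
  fin_cases j <;> simp [Matrix.mulVec, dotProduct, h0]

theorem exists_upper_ne_zero (h : IrreducibleWithRealTraces A) : ∃ i, A i 0 1 ≠ 0 := by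
  by_contra! h0
  refine h.irreducible ⟨![0, 1], fun hw => by simpa using congrFun hw 1, fun i => ⟨A i 1 1, ?_⟩⟩
  ext j
  fin_cases j <;> simp [Matrix.mulVec, dotProduct, h0]

open ComplexConjugate

/-- A family containing an elliptic diagonal matrix preserves a nondegenerate diagonal Hermitian
form. -/
theorem exists_entries_of_elliptic (h : IrreducibleWithRealTraces A) {k : ι} {z : ℂ}
    (hz : z.im ≠ 0) (hk : A k = !![z, 0; 0, conj z]) :
    ∃ κ : ℝ, κ ≠ 0 ∧ ∀ i, A i 1 1 = conj (A i 0 0) ∧ A i 1 0 = κ * conj (A i 0 1) := by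
  have hne : conj z - z ≠ 0 := fun h0 => hz (Complex.conj_eq_iff_im.mp (sub_eq_zero.mp h0))
  have hdiag : ∀ i, A i 1 1 = conj (A i 0 0) := fun i => by
    have e1 := Complex.conj_eq_iff_im.mpr (h.trace_im i)
    have e2 := Complex.conj_eq_iff_im.mpr (h.trace_mul_im i k)
    simp [hk, Matrix.trace_fin_two, Matrix.mul_apply, Fin.sum_univ_two] at e1 e2
    apply mul_left_cancel₀ hne
    linear_combination z * e1 - e2
  have hoff : ∀ i j, A i 1 0 * A j 0 1 = conj (A i 0 1) * conj (A j 1 0) := fun i j => by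
    have e1 := Complex.conj_eq_iff_im.mpr (h.trace_mul_im i j)
    have e2 := Complex.conj_eq_iff_im.mpr (h.trace_mul_mul_im i k j)
    simp [hk, Matrix.trace_fin_two, Matrix.mul_apply, Fin.sum_univ_two, hdiag] at e1 e2
    apply mul_left_cancel₀ hne
    linear_combination e2 - conj z * e1
  obtain ⟨l, hl⟩ := h.exists_upper_ne_zero
  obtain ⟨m, hm⟩ := h.exists_lower_ne_zero
  have hl' : conj (A l 0 1) ≠ 0 := (map_ne_zero _).mpr hl
  have hl1 : A l 1 0 ≠ 0 := fun h0 => by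
    have := hoff l m
    rw [h0, zero_mul] at this
    exact mul_ne_zero hl' ((map_ne_zero _).mpr hm) this.symm
  have hreal : conj (A l 1 0 / conj (A l 0 1)) = A l 1 0 / conj (A l 0 1) := by
    rw [map_div₀, Complex.conj_conj, div_eq_div_iff hl hl']
    linear_combination -hoff l l
  obtain ⟨κ, hκ⟩ := Complex.conj_eq_iff_real.mp hreal
  refine ⟨κ, fun h0 => ?_, fun i => ⟨hdiag i, ?_⟩⟩
  · rw [h0, Complex.ofReal_zero] at hκ
    exact div_ne_zero hl1 hl' hκ
  · have e := hoff i l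
    have hκ' : conj (A l 1 0) = κ * A l 0 1 := by
      rw [div_eq_iff hl'] at hκ
      rw [hκ, map_mul, Complex.conj_ofReal, Complex.conj_conj]
    apply mul_right_cancel₀ hl
    rw [e, hκ']
    ring

theorem isConjugateInto_of_elliptic (h : IrreducibleWithRealTraces A) {k : ι} {z : ℂ}
    (hz : z.im ≠ 0) (hk : A k = !![z, 0; 0, conj z]) :
    IsConjugateInto A (Matrix.specialUnitaryGroup (Fin 2) ℂ) ∨ IsConjugateInto A realEntries := by
  obtain ⟨κ, hκ, hA⟩ := h.exists_entries_of_elliptic hz hk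
  rcases lt_or_gt_of_ne hκ with hneg | hpos
  · left
    obtain ⟨a, ha, hak⟩ : ∃ a : ℝ, a ≠ 0 ∧ κ = -(a * a) :=
      ⟨√(-κ), (Real.sqrt_pos.mpr (by linarith)).ne', by rw [Real.mul_self_sqrt] <;> linarith⟩
    have ha' : (a : ℂ) ≠ 0 := by exact_mod_cast ha
    have hPQ : !![(a : ℂ), 0; 0, 1] * !![(a : ℂ)⁻¹, 0; 0, 1] = 1 := by
      rw [Matrix.one_fin_two]; simp [ha']
    refine ⟨_, _, hPQ, fun i => ?_⟩
    have hdet := h.det_eq_one i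
    rw [SetLike.mem_coe, Matrix.mem_specialUnitaryGroup_iff]
    refine ⟨?_, by rw [det_conj_eq (mul_eq_one_comm.mp hPQ), hdet]⟩
    have hB : !![(a : ℂ), 0; 0, 1] * A i * !![(a : ℂ)⁻¹, 0; 0, 1] =
        !![A i 0 0, a * A i 0 1; -(a * conj (A i 0 1)), conj (A i 0 0)] := by
      rw [Matrix.eta_fin_two (A i), (hA i).1, (hA i).2, hak]
      ext r s
      fin_cases r <;> fin_cases s <;> simp <;> field_simp
    rw [Matrix.det_fin_two, (hA i).1, (hA i).2, hak] at hdet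
    push_cast at hdet
    rw [hB, Matrix.mem_unitaryGroup_iff, Matrix.star_eq_conjTranspose, Matrix.one_fin_two]
    ext r s
    fin_cases r <;> fin_cases s <;>
      simp [Matrix.mul_apply, Fin.sum_univ_two, Matrix.conjTranspose_apply] <;>
      first | (ring; done) | linear_combination hdet
  · right
    obtain ⟨a, ha, hak⟩ : ∃ a : ℝ, a ≠ 0 ∧ κ = a * a :=
      ⟨√κ, (Real.sqrt_pos.mpr hpos).ne', (Real.mul_self_sqrt hpos.le).symm⟩
    have ha' : (a : ℂ) ≠ 0 := by exact_mod_cast ha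
    refine ⟨!![(a : ℂ) / 2, 1 / 2; -Complex.I * a / 2, Complex.I / 2],
      !![(a : ℂ)⁻¹, Complex.I * (a : ℂ)⁻¹; 1, -Complex.I], ?_, fun i => ?_⟩
    · rw [Matrix.one_fin_two]
      ext r s
      fin_cases r <;> fin_cases s <;> simp <;> field_simp <;> ring_nf <;> simp
    · have hB : !![(a : ℂ) / 2, 1 / 2; -Complex.I * a / 2, Complex.I / 2] * A i *
          !![(a : ℂ)⁻¹, Complex.I * (a : ℂ)⁻¹; 1, -Complex.I] =
          !![(((A i 0 0).re + a * (A i 0 1).re : ℝ) : ℂ),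
              ((-(A i 0 0).im + a * (A i 0 1).im : ℝ) : ℂ);
            (((A i 0 0).im + a * (A i 0 1).im : ℝ) : ℂ),
              (((A i 0 0).re - a * (A i 0 1).re : ℝ) : ℂ)] := by
        rw [Matrix.eta_fin_two (A i), (hA i).1, (hA i).2, hak]
        ext r s
        fin_cases r <;> fin_cases s <;> simp <;> field_simp <;>
          simp [Complex.ext_iff, pow_two] <;> ring_nf <;> simp
      rw [hB]
      intro r s
      fin_cases r <;> fin_cases s <;> simp only [Matrix.of_apply, Matrix.cons_val,
        Fin.zero_eta, Fin.mk_one, Complex.ofReal_im]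

theorem isConjugateInto_of_hyperbolic (h : IrreducibleWithRealTraces A) {k : ι} {x y : ℝ}
    (hxy : x ≠ y) (hk : A k = !![(x : ℂ), 0; 0, (y : ℂ)]) : IsConjugateInto A realEntries := by
  have hdiag : ∀ i, (A i 0 0).im = 0 ∧ (A i 1 1).im = 0 := fun i => by
    have e1 := h.trace_im i
    have e2 := h.trace_mul_im i k
    simp [hk, Matrix.trace_fin_two, Matrix.mul_apply, Fin.sum_univ_two] at e1 e2
    have : (A i 0 0).im = 0 := by
      apply mul_left_cancel₀ (sub_ne_zero.mpr hxy)
      linear_combination e2 - y * e1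
    exact ⟨this, by linarith⟩
  have hoff : ∀ i j, (A i 0 1 * A j 1 0).im = 0 := fun i j => by
    have e1 := h.trace_mul_im i j
    have e2 := h.trace_mul_mul_im i k j
    simp [hk, Matrix.trace_fin_two, Matrix.mul_apply, Fin.sum_univ_two, hdiag] at e1 e2
    rw [Complex.mul_im]
    apply mul_left_cancel₀ (sub_ne_zero.mpr hxy)
    linear_combination x * e1 - e2
  obtain ⟨l, hl⟩ := h.exists_upper_ne_zero
  obtain ⟨m, hm⟩ := h.exists_lower_ne_zero
  refine ⟨!![1, 0; 0, A l 0 1], !![1, 0; 0, (A l 0 1)⁻¹], ?_, fun i => ?_⟩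
  · rw [Matrix.one_fin_two]; simp [hl]
  have hup : (A i 0 1 * (A l 0 1)⁻¹).im = 0 := by
    have e : A i 0 1 * (A l 0 1)⁻¹ = A i 0 1 * A m 1 0 * (A l 0 1 * A m 1 0)⁻¹ := by
      field_simp
    rw [e]
    simp only [Complex.mul_im (_ * _), Complex.inv_im, hoff]
    simp
  rw [Matrix.eta_fin_two (A i)]
  intro r s
  fin_cases r <;> fin_cases s
  · simpa using (hdiag i).1
  · simpa using hup
  · simpa using hoff l i
  · have e : A l 0 1 * A i 1 1 * (A l 0 1)⁻¹ = A i 1 1 := by field_simp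
    simpa [e, -Complex.mul_im] using (hdiag i).2

theorem mem_realEntries_of_parabolic (h : IrreducibleWithRealTraces A) {k m : ι} {x : ℝ}
    (hk : A k = !![(x : ℂ), 1; 0, (x : ℂ)]) (hm : A m 1 0 ≠ 0) (hm0 : A m 0 0 = 0) (i : ι) :
    A i ∈ realEntries := by
  have hlow : ∀ i, (A i 1 0).im = 0 := fun i => by
    have e1 := h.trace_im i
    have e2 := h.trace_mul_im i k
    simp [hk, Matrix.trace_fin_two, Matrix.mul_apply, Fin.sum_univ_two] at e1 e2
    linear_combination e2 - x * e1
  have hmix : ∀ i j, (A i 0 0 * A j 1 0 + A i 1 0 * A j 1 1).im = 0 := fun i j => by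
    have e1 := h.trace_mul_im i j
    have e2 := h.trace_mul_mul_im i k j
    simp [hk, Matrix.trace_fin_two, Matrix.mul_apply, Fin.sum_univ_two] at e1 e2
    simp
    linear_combination e2 - x * e1
  have hm' : (A m 1 0).re ≠ 0 := fun h0 => hm (Complex.ext h0 (hlow m))
  have h11 : ∀ i, (A i 1 1).im = 0 := fun i => by
    simpa [hm0, hlow, hm'] using hmix m i
  have h00 : ∀ i, (A i 0 0).im = 0 := fun i => by
    simpa [hlow, hm', h11] using hmix i m
  have hup : ∀ i, (A m 0 1).im * (A i 1 0).re + (A m 1 0).re * (A i 0 1).im = 0 := fun i => by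
    have e := h.trace_mul_im m i
    simp [Matrix.trace_fin_two, Matrix.mul_apply, Fin.sum_univ_two, hlow, h00, h11] at e
    linear_combination e
  have hm01 : (A m 0 1).im = 0 := by
    apply mul_left_cancel₀ hm'
    linear_combination hup m / 2
  have h01 : (A i 0 1).im = 0 := by simpa [hm01, hm'] using hup i
  intro r s
  fin_cases r <;> fin_cases s
  exacts [h00 i, h01, hlow i, h11 i]

theorem isConjugateInto_of_parabolic (h : IrreducibleWithRealTraces A) {k : ι} {x : ℝ}
    (hk : A k = !![(x : ℂ), 1; 0, (x : ℂ)]) : IsConjugateInto A realEntries := by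
  obtain ⟨m, hm⟩ := h.exists_lower_ne_zero
  have hPQ : !![1, -(A m 0 0 / A m 1 0); 0, 1] * !![1, A m 0 0 / A m 1 0; 0, 1] = 1 := by
    rw [Matrix.one_fin_two]; simp
  refine ⟨_, _, hPQ, (h.conj hPQ).mem_realEntries_of_parabolic (k := k) (m := m) (x := x) ?_ ?_ ?_⟩
  · rw [hk]
    ext r s
    fin_cases r <;> fin_cases s <;> simp
    ring
  · rw [Matrix.eta_fin_two (A m)]
    simpa using hm
  · rw [Matrix.eta_fin_two (A m)]
    simp [hm]

theorem exists_cyclic_vector (h : IrreducibleWithRealTraces A) :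
    ∃ k, ∃ u v : ℂ, u * (A k 1 0 * u + A k 1 1 * v) - v * (A k 0 0 * u + A k 0 1 * v) ≠ 0 := by
  by_contra! h0
  obtain ⟨k, hk⟩ := h.exists_lower_ne_zero
  exact hk (by simpa using h0 k 1 0)

theorem isConjugateInto (h : IrreducibleWithRealTraces A) :
    IsConjugateInto A (Matrix.specialUnitaryGroup (Fin 2) ℂ) ∨ IsConjugateInto A realEntries := by
  obtain ⟨k, u, v, huv⟩ := h.exists_cyclic_vector
  have hdet := h.det_eq_one k
  obtain ⟨t, ht⟩ : ∃ t : ℝ, (A k).trace = t :=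
    ⟨(A k).trace.re, Complex.ext rfl (h.trace_im k)⟩
  rcases lt_trichotomy (t ^ 2) 4 with hlt | heq | hgt
  · have hpos : 0 < 1 - t ^ 2 / 4 := by linarith
    set z : ℂ := ⟨t / 2, √(1 - t ^ 2 / 4)⟩ with hz
    have hzim : z.im ≠ 0 := (Real.sqrt_pos.mpr hpos).ne'
    have hsum : (A k).trace = z + conj z := by
      rw [ht, Complex.add_conj]; simp only [hz]; push_cast; ring
    have hprod : (A k).det = z * conj z := by
      rw [hdet, Complex.mul_conj, Complex.normSq_apply]
      simp only [hz, Real.mul_self_sqrt hpos.le]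
      norm_cast
      ring
    obtain ⟨P, Q, hPQ, hK⟩ := exists_conj_eq_diagonal huv hsum hprod
      fun h0 => hzim (Complex.conj_eq_iff_im.mp h0.symm)
    exact ((h.conj hPQ).isConjugateInto_of_elliptic hzim hK).imp
      (IsConjugateInto.of_conj hPQ) (IsConjugateInto.of_conj hPQ)
  · have hsum : (A k).trace = ((t / 2 : ℝ) : ℂ) + ((t / 2 : ℝ) : ℂ) := by
      rw [ht]; push_cast; ring
    have hprod : (A k).det = ((t / 2 : ℝ) : ℂ) * ((t / 2 : ℝ) : ℂ) := by
      rw [hdet]; norm_cast; linarith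
    obtain ⟨P, Q, hPQ, hK⟩ := exists_conj_eq_jordan huv hsum hprod
    exact Or.inr (((h.conj hPQ).isConjugateInto_of_parabolic hK).of_conj hPQ)
  · have hpos : 0 < t ^ 2 / 4 - 1 := by linarith
    set d := √(t ^ 2 / 4 - 1) with hd
    have hd0 : 0 < d := Real.sqrt_pos.mpr hpos
    have hdd : d * d = t ^ 2 / 4 - 1 := Real.mul_self_sqrt hpos.le
    have hne : t / 2 + d ≠ t / 2 - d := by linarith
    have hsum : (A k).trace = ((t / 2 + d : ℝ) : ℂ) + ((t / 2 - d : ℝ) : ℂ) := by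
      rw [ht]; push_cast; ring
    have hprod : (A k).det = ((t / 2 + d : ℝ) : ℂ) * ((t / 2 - d : ℝ) : ℂ) := by
      rw [hdet]; norm_cast; linear_combination hdd
    obtain ⟨P, Q, hPQ, hK⟩ := exists_conj_eq_diagonal huv hsum hprod
      fun h0 => hne (Complex.ofReal_injective h0)
    exact Or.inr (((h.conj hPQ).isConjugateInto_of_hyperbolic hne hK).of_conj hPQ)

end IrreducibleWithRealTraces

theorem mul_mem_realEntries {X Y : Matrix (Fin 2) (Fin 2) ℂ} (hX : X ∈ realEntries)
    (hY : Y ∈ realEntries) : X * Y ∈ realEntries := fun i j => by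
  simp [Matrix.mul_apply, Fin.sum_univ_two, hX _ _, hY _ _]

theorem adjugate_mem_realEntries {X : Matrix (Fin 2) (Fin 2) ℂ} (hX : X ∈ realEntries) :
    X.adjugate ∈ realEntries := fun i j => by
  rw [Matrix.adjugate_fin_two]
  fin_cases i <;> fin_cases j <;> simp [hX _ _]

/-- An irreducible quadruple in SL(2,ℂ) with product the identity, all of whose
seven trace coordinates are real, is an SU(2)-class or an SL(2,ℝ)-class. -/
theorem real_traces_su2_or_sl2r
    (A1 A2 A3 A4 : Matrix (Fin 2) (Fin 2) ℂ)
    (h1 : A1.det = 1) (h2 : A2.det = 1) (h3 : A3.det = 1) (h4 : A4.det = 1)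
    (hprod : A1 * A2 * A3 * A4 = 1)
    (hirr : ¬∃ w : Fin 2 → ℂ, w ≠ 0 ∧
      ∀ B ∈ ({A1, A2, A3, A4} : Set (Matrix (Fin 2) (Fin 2) ℂ)),
        ∃ c : ℂ, B.mulVec w = c • w)
    (ht1 : A1.trace.im = 0) (ht2 : A2.trace.im = 0)
    (ht3 : A3.trace.im = 0) (ht4 : A4.trace.im = 0)
    (hv1 : (A1 * A2).trace.im = 0) (hv2 : (A2 * A3).trace.im = 0)
    (hv3 : (A1 * A3).trace.im = 0) :
    IsSU2Class A1 A2 A3 A4 ∨ IsSL2RClass A1 A2 A3 A4 := by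
  have h123 : (A1 * A2 * A3).det = 1 := by simp [h1, h2, h3]
  have hA4 : A4 = (A1 * A2 * A3).adjugate := by
    rw [← Matrix.mul_one (A1 * A2 * A3).adjugate, ← hprod, ← Matrix.mul_assoc,
      Matrix.adjugate_mul, h123, one_smul, Matrix.one_mul]
  have ht123 : (A1 * A2 * A3).trace.im = 0 := by
    rw [hA4, Matrix.adjugate_fin_two, Matrix.trace_fin_two_of] at ht4
    rwa [Matrix.trace_fin_two, add_comm]
  have hdet : ∀ i, (![A1, A2, A3] i).det = 1 := by simp [Fin.forall_fin_succ, h1, h2, h3]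
  have htr : ∀ i, (![A1, A2, A3] i).trace.im = 0 := by
    simp [Fin.forall_fin_succ, ht1, ht2, ht3]
  have htr2 : ∀ i j, (![A1, A2, A3] i * ![A1, A2, A3] j).trace.im = 0 := by
    have hsq : ∀ X : Matrix (Fin 2) (Fin 2) ℂ, X.det = 1 → X.trace.im = 0 →
        (X * X).trace.im = 0 := fun X hX hX' => by
      simpa [hX, hX'] using congrArg Complex.im (trace_mul_self_mul X 1)
    simp [Fin.forall_fin_succ, hv1, hv2, hv3, hsq, h1, h2, h3, ht1, ht2, ht3,
      Matrix.trace_mul_comm A2 A1, Matrix.trace_mul_comm A3 A2, Matrix.trace_mul_comm A3 A1]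
  have h : IrreducibleWithRealTraces ![A1, A2, A3] := by
    refine ⟨hdet, htr, htr2, trace_mul_mul_im_eq_zero hdet htr htr2 ht123, ?_⟩
    rintro ⟨w, hw, hc⟩
    obtain ⟨c1, hc1⟩ := hc 0
    obtain ⟨c2, hc2⟩ := hc 1
    obtain ⟨c3, hc3⟩ := hc 2
    simp only [Matrix.cons_val] at hc1 hc2 hc3
    have hc4 : (c1 * c2 * c3) • A4.mulVec w = w := by
      calc (c1 * c2 * c3) • A4.mulVec w = A4.mulVec ((A1 * A2 * A3).mulVec w) := by
            simp only [← Matrix.mulVec_mulVec, hc3, Matrix.mulVec_smul, hc2, hc1, smul_smul]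
            congr 1
            ring
        _ = w := by
            rw [Matrix.mulVec_mulVec, mul_eq_one_comm.mp hprod, Matrix.one_mulVec]
    have hc0 : c1 * c2 * c3 ≠ 0 := fun h0 => hw (by rw [← hc4, h0, zero_smul])
    refine hirr ⟨w, hw, ?_⟩
    rintro B (rfl | rfl | rfl | rfl)
    exacts [⟨c1, hc1⟩, ⟨c2, hc2⟩, ⟨c3, hc3⟩,
      ⟨(c1 * c2 * c3)⁻¹, by rw [eq_inv_smul_iff₀ hc0, hc4]⟩]
  have hprod' : ∀ P Q : Matrix (Fin 2) (Fin 2) ℂ, Q * P = 1 →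
      P * A1 * Q * (P * A2 * Q) * (P * A3 * Q) = P * (A1 * A2 * A3) * Q := fun P Q hQP => by
    rw [conj_mul_conj hQP, conj_mul_conj hQP]
  refine h.isConjugateInto.imp ?_ ?_
  · rintro ⟨P, Q, hPQ, hA⟩
    have hQP := mul_eq_one_comm.mp hPQ
    have hB1 := hA 0
    have hB2 := hA 1
    have hB3 := hA 2
    simp only [Matrix.cons_val, SetLike.mem_coe] at hB1 hB2 hB3
    have hU := mul_mem (mul_mem hB1 hB2) hB3
    have hB4 : P * A4 * Q ∈ Matrix.specialUnitaryGroup (Fin 2) ℂ := by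
      rw [hprod' P Q hQP] at hU
      have hinv : P * (A1 * A2 * A3) * Q * (P * A4 * Q) = 1 := by
        rw [conj_mul_conj hQP, hprod, Matrix.mul_one, hPQ]
      have hstar := Matrix.mem_unitaryGroup_iff'.mp
        (Matrix.mem_specialUnitaryGroup_iff.mp hU).1
      rw [Matrix.mem_specialUnitaryGroup_iff, det_conj_eq hQP,
        ← left_inv_eq_right_inv hstar hinv]
      exact ⟨Unitary.star_mem (Matrix.mem_specialUnitaryGroup_iff.mp hU).1, h4⟩
    refine ⟨⟨P, Q, hPQ, hQP⟩, ?_⟩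
    rintro B (rfl | rfl | rfl | rfl)
    exacts [Matrix.mem_specialUnitaryGroup_iff.mp hB1, Matrix.mem_specialUnitaryGroup_iff.mp hB2,
      Matrix.mem_specialUnitaryGroup_iff.mp hB3, Matrix.mem_specialUnitaryGroup_iff.mp hB4]
  · rintro ⟨P, Q, hPQ, hA⟩
    have hQP := mul_eq_one_comm.mp hPQ
    have hB1 := hA 0
    have hB2 := hA 1
    have hB3 := hA 2
    simp only [Matrix.cons_val] at hB1 hB2 hB3
    have hR := mul_mem_realEntries (mul_mem_realEntries hB1 hB2) hB3
    have hB4 : P * A4 * Q ∈ realEntries := by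
      rw [hprod' P Q hQP] at hR
      have hinv : P * (A1 * A2 * A3) * Q * (P * A4 * Q) = 1 := by
        rw [conj_mul_conj hQP, hprod, Matrix.mul_one, hPQ]
      have hadj : (P * (A1 * A2 * A3) * Q).adjugate * (P * (A1 * A2 * A3) * Q) = 1 := by
        rw [Matrix.adjugate_mul, det_conj_eq hQP, h123, one_smul]
      rw [← left_inv_eq_right_inv hadj hinv]
      exact adjugate_mem_realEntries hR
    refine ⟨⟨P, Q, hPQ, hQP⟩, ?_⟩
    rintro B (rfl | rfl | rfl | rfl)
    exacts [hB1, hB2, hB3, hB4]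
end

section
/- Let A = (A₁,A₂,A₃,A₄) be a quadruple of matrices in SL(2,ℂ) with A₁A₂A₃A₄ = I. Suppose a₁ = tr A₁ and a₂ = tr A₂ are real with a₁, a₂ ∈ (−2,2), that v₁ = tr(A₁A₂) is real and satisfies a₁² + a₂² + v₁² − a₁a₂v₁ − 4 < 0 (equivalently, v₁ lies in the open interior of the interval I_{a₁,a₂}), and that tr A₃, tr A₄, tr(A₂A₃) and tr(A₁A₃) are all real. Then A is an SU(2)-class. -/
open Matrix

open ComplexConjugate

/-- Matrices `!![z, w; -conj w, conj z]` of determinant one are unitary. -/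
theorem mem_unitaryGroup_of_conj_entries {M : Matrix (Fin 2) (Fin 2) ℂ} (hdet : M.det = 1)
    (hdiag : M 1 1 = conj (M 0 0)) (hoff : M 1 0 = -conj (M 0 1)) :
    M ∈ Matrix.unitaryGroup (Fin 2) ℂ := by
  rw [Matrix.det_fin_two, hdiag, hoff] at hdet
  rw [Matrix.mem_unitaryGroup_iff]
  ext i j
  fin_cases i <;> fin_cases j <;>
    simp [Matrix.mul_apply, Fin.sum_univ_two, Matrix.star_apply, hdiag, hoff]
  · linear_combination hdet
  · ring
  · ring
  · linear_combination hdet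

/-- Conjugating all four matrices does not affect being an SU(2)-class. -/
theorem IsSU2Class.of_conj (g : GL (Fin 2) ℂ) {A1 A2 A3 A4 : Matrix (Fin 2) (Fin 2) ℂ}
    (h : IsSU2Class (g.1 * A1 * (g⁻¹).1) (g.1 * A2 * (g⁻¹).1) (g.1 * A3 * (g⁻¹).1)
      (g.1 * A4 * (g⁻¹).1)) : IsSU2Class A1 A2 A3 A4 := by
  obtain ⟨k, hk⟩ := h
  refine ⟨k * g, fun B hB => ?_⟩
  have hconj : (k * g).1 * B * ((k * g)⁻¹).1 = k.1 * (g.1 * B * (g⁻¹).1) * (k⁻¹).1 := by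
    rw [_root_.mul_inv_rev, Units.val_mul, Units.val_mul]
    simp only [Matrix.mul_assoc]
  rw [hconj]
  apply hk
  rcases hB with rfl | rfl | rfl | rfl <;> simp

theorem trace_conj_GL (g : GL (Fin 2) ℂ) (A : Matrix (Fin 2) (Fin 2) ℂ) :
    (g.1 * A * (g⁻¹).1).trace = A.trace := by
  rw [Matrix.trace_mul_comm, ← Matrix.mul_assoc, Units.inv_mul, Matrix.one_mul]

theorem det_conj_GL (g : GL (Fin 2) ℂ) (A : Matrix (Fin 2) (Fin 2) ℂ) :
    (g.1 * A * (g⁻¹).1).det = A.det := by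
  rw [Matrix.det_mul_comm, ← Matrix.mul_assoc, Units.inv_mul, Matrix.one_mul]

theorem conj_GL_mul (g : GL (Fin 2) ℂ) (A B : Matrix (Fin 2) (Fin 2) ℂ) :
    (g.1 * A * (g⁻¹).1) * (g.1 * B * (g⁻¹).1) = g.1 * (A * B) * (g⁻¹).1 := by
  simp only [Matrix.mul_assoc]
  rw [← Matrix.mul_assoc (g⁻¹).1, Units.inv_mul, Matrix.one_mul]

/-- A `2 × 2` matrix whose characteristic polynomial has two distinct roots is diagonalizable. -/
theorem exists_conj_eq_diagonal_s8 {A : Matrix (Fin 2) (Fin 2) ℂ} {u w : ℂ} (huw : u ≠ w)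
    (htr : A.trace = u + w) (hdet : A.det = u * w) :
    ∃ g : GL (Fin 2) ℂ, g.1 * A * (g⁻¹).1 = !![u, 0; 0, w] := by
  rw [Matrix.trace_fin_two] at htr
  rw [Matrix.det_fin_two] at hdet
  have eigenvector : ∀ x : ℂ, (x - u) * (x - w) = 0 →
      ∃ v ≠ 0, (A - x • (1 : Matrix (Fin 2) (Fin 2) ℂ)) *ᵥ v = 0 := by
    intro x hx
    rw [Matrix.exists_mulVec_eq_zero_iff, Matrix.det_fin_two]
    simp
    linear_combination hx + hdet - x * htr
  obtain ⟨v, hv, hAv⟩ := eigenvector u (by ring)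
  obtain ⟨y, hy, hAy⟩ := eigenvector w (by ring)
  have hv0 := congrFun hAv 0
  have hv1 := congrFun hAv 1
  have hy0 := congrFun hAy 0
  have hy1 := congrFun hAy 1
  simp [Matrix.mulVec, dotProduct, Fin.sum_univ_two] at hv0 hv1 hy0 hy1
  let P : Matrix (Fin 2) (Fin 2) ℂ := !![v 0, y 0; v 1, y 1]
  have hP : P.det ≠ 0 := by
    intro h
    obtain ⟨z, hz, hPz⟩ := Matrix.exists_mulVec_eq_zero_iff.mpr h
    have hz0 := congrFun hPz 0
    have hz1 := congrFun hPz 1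
    simp [P, Matrix.mulVec, dotProduct, Fin.sum_univ_two] at hz0 hz1
    have hsub : u - w ≠ 0 := sub_ne_zero.mpr huw
    have hzv0 : (u - w) * (z 0 * v 0) = 0 := by
      linear_combination (A 0 0 - w) * hz0 + A 0 1 * hz1 - z 0 * hv0 - z 1 * hy0
    have hzv1 : (u - w) * (z 0 * v 1) = 0 := by
      linear_combination A 1 0 * hz0 + (A 1 1 - w) * hz1 - z 0 * hv1 - z 1 * hy1
    have hz0v : z 0 = 0 := by
      by_contra hne
      apply hv
      ext i
      fin_cases i <;> simp_all
    have hz1y : z 1 = 0 := by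
      by_contra hne
      apply hy
      ext i
      fin_cases i <;> simp_all
    apply hz
    ext i
    fin_cases i <;> simp [hz0v, hz1y]
  let g := Matrix.GeneralLinearGroup.mkOfDetNeZero P hP
  refine ⟨g⁻¹, ?_⟩
  have hAP : A * g.1 = g.1 * !![u, 0; 0, w] := by
    change A * P = P * _
    ext i j
    fin_cases i <;> fin_cases j <;> simp [P, Matrix.mul_apply, Fin.sum_univ_two]
    · linear_combination hv0
    · linear_combination hy0
    · linear_combination hv1
    · linear_combination hy1
  rw [inv_inv, Matrix.mul_assoc, hAP, ← Matrix.mul_assoc, Units.inv_mul, Matrix.one_mul]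

/-- If the traces of `M` and of `diag(u, conj u) * M` are real and `u` is not real, then the
diagonal entries of `M` are conjugate. -/
theorem diag_conj_of_traces_real {u : ℂ} (hu : u.im ≠ 0) {M : Matrix (Fin 2) (Fin 2) ℂ}
    (ht : M.trace.im = 0) (hut : (!![u, 0; 0, conj u] * M).trace.im = 0) :
    M 1 1 = conj (M 0 0) := by
  simp [Matrix.trace_fin_two, Matrix.vecMul, dotProduct, Fin.sum_univ_two] at ht hut
  apply Complex.ext
  · have : u.im * ((M 1 1).re - (M 0 0).re) = 0 := by linear_combination u.re * ht - hut
    simpa [hu, sub_eq_zero] using this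
  · simp
    linear_combination ht

/-- If `p + q` and `u * p + conj u * q` are real and `u` is not real, then `q = conj p`. -/
theorem eq_conj_of_im_eq_zero {u p q : ℂ} (hu : u.im ≠ 0) (h : (p + q).im = 0)
    (h' : (u * p + conj u * q).im = 0) : q = conj p := by
  simp at h h'
  apply Complex.ext
  · have : u.im * (q.re - p.re) = 0 := by linear_combination u.re * h - h'
    simpa [hu, sub_eq_zero] using this
  · simp
    linear_combination h

/-- Normal form: `A1` is diagonal and `A2` is already unitary. -/
theorem isSU2Class_of_normal_form {u : ℂ} (hu : u.im ≠ 0) (hnorm : u * conj u = 1)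
    {A2 A3 A4 : Matrix (Fin 2) (Fin 2) ℂ} (h2 : A2.det = 1) (h3 : A3.det = 1)
    (hprod : !![u, 0; 0, conj u] * A2 * A3 * A4 = 1)
    (hdiag : A2 1 1 = conj (A2 0 0)) (hoff : A2 1 0 = -conj (A2 0 1)) (hne : A2 0 1 ≠ 0)
    (ht3 : A3.trace.im = 0) (ht4 : A4.trace.im = 0)
    (hv2 : (A2 * A3).trace.im = 0) (hv3 : (!![u, 0; 0, conj u] * A3).trace.im = 0) :
    IsSU2Class !![u, 0; 0, conj u] A2 A3 A4 := by
  have hdiag3 := diag_conj_of_traces_real hu ht3 hv3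
  have hN : (!![u, 0; 0, conj u] * A2 * A3).det = 1 := by
    rw [Matrix.det_mul, Matrix.det_mul, h2, h3, Matrix.det_fin_two_of]
    linear_combination hnorm
  have hA4 : A4 = (!![u, 0; 0, conj u] * A2 * A3).adjugate := by
    rw [← Matrix.mul_one (Matrix.adjugate _), ← hprod, ← Matrix.mul_assoc,
      Matrix.adjugate_mul, hN, one_smul, Matrix.one_mul]
  have hoff3 : A3 1 0 = -conj (A3 0 1) := by
    rw [hA4] at ht4
    have hqr : A2 1 0 * A3 0 1 = conj (A2 0 1 * A3 1 0) := by
      apply eq_conj_of_im_eq_zero hu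
      · simp [Matrix.trace_fin_two, Matrix.mul_apply, Fin.sum_univ_two, hdiag, hdiag3] at hv2 ⊢
        linear_combination hv2
      · simp [Matrix.trace_fin_two, Matrix.adjugate_fin_two,
          Matrix.vecMul, dotProduct, Matrix.mul_apply, Fin.sum_univ_two, hdiag, hdiag3] at ht4 ⊢
        linear_combination ht4
    rw [hoff, map_mul] at hqr
    have hne' : conj (A2 0 1) ≠ 0 := by simpa using hne
    have h : conj (A3 1 0) = -A3 0 1 := by
      apply mul_left_cancel₀ hne'
      linear_combination -hqr
    rw [← Complex.conj_conj (A3 1 0), h, map_neg]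
  have hD : (!![u, 0; 0, conj u] : Matrix (Fin 2) (Fin 2) ℂ).det = 1 := by
    rw [Matrix.det_fin_two_of]
    linear_combination hnorm
  have hUD := mem_unitaryGroup_of_conj_entries hD (by simp) (by simp)
  have hU2 := mem_unitaryGroup_of_conj_entries h2 hdiag hoff
  have hU3 := mem_unitaryGroup_of_conj_entries h3 hdiag3 hoff3
  have hU := mul_mem (mul_mem hUD hU2) hU3
  have hU4 : A4 ∈ Matrix.unitaryGroup (Fin 2) ℂ := by
    rw [← Matrix.one_mul A4, ← Matrix.mem_unitaryGroup_iff'.mp hU, Matrix.mul_assoc, hprod,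
      Matrix.mul_one]
    exact Unitary.star_mem hU
  have h4 : A4.det = 1 := by
    rw [hA4, Matrix.det_adjugate, hN, one_pow]
  refine ⟨1, fun B hB => ?_⟩
  rw [inv_one, Units.val_one, Matrix.one_mul, Matrix.mul_one]
  rcases hB with rfl | rfl | rfl | rfl
  exacts [⟨hUD, hD⟩, ⟨hU2, h2⟩, ⟨hU3, h3⟩, ⟨hU4, h4⟩]

/-- A diagonal conjugation makes the off-diagonal entries anti-conjugate as soon as their product
is a negative real number. -/
theorem exists_diagonal_conj {B : Matrix (Fin 2) (Fin 2) ℂ} {ρ : ℝ} (hρ : 0 < ρ)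
    (hB : B 0 1 * B 1 0 = -(ρ : ℂ)) :
    ∃ g : GL (Fin 2) ℂ, (∀ u w : ℂ, g.1 * !![u, 0; 0, w] * (g⁻¹).1 = !![u, 0; 0, w]) ∧
      (g.1 * B * (g⁻¹).1) 0 1 ≠ 0 ∧
      (g.1 * B * (g⁻¹).1) 1 0 = -conj ((g.1 * B * (g⁻¹).1) 0 1) := by
  have hq : B 0 1 ≠ 0 := by
    intro h
    rw [h, zero_mul, eq_comm, neg_eq_zero, Complex.ofReal_eq_zero] at hB
    exact hρ.ne' hB
  let d : ℝ := √ρ / ‖B 0 1‖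
  have hd : d ≠ 0 := (div_pos (Real.sqrt_pos.mpr hρ) (norm_pos_iff.mpr hq)).ne'
  have hdC : (d : ℂ) ≠ 0 := Complex.ofReal_ne_zero.mpr hd
  have hd2 : (d : ℂ) ^ 2 * (B 0 1 * conj (B 0 1)) = ρ := by
    rw [Complex.mul_conj', ← Complex.ofReal_pow, ← Complex.ofReal_pow, ← Complex.ofReal_mul,
      div_pow, Real.sq_sqrt hρ.le,
      div_mul_cancel₀ _ (pow_ne_zero 2 (norm_ne_zero_iff.mpr hq))]
  let g : GL (Fin 2) ℂ := ⟨!![(d : ℂ), 0; 0, 1], !![(d : ℂ)⁻¹, 0; 0, 1],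
    by simp [hdC, Matrix.one_fin_two], by simp [hdC, Matrix.one_fin_two]⟩
  have hg : g.1 = !![(d : ℂ), 0; 0, 1] := rfl
  have hg' : (g⁻¹).1 = !![(d : ℂ)⁻¹, 0; 0, 1] := rfl
  have h01 : (g.1 * B * (g⁻¹).1) 0 1 = d * B 0 1 := by
    simp [hg, hg', Matrix.mul_apply, Matrix.vecMul, dotProduct, Fin.sum_univ_two]
  have h10 : (g.1 * B * (g⁻¹).1) 1 0 = B 1 0 * (d : ℂ)⁻¹ := by
    simp [hg, hg', Matrix.mul_apply, Matrix.vecMul, dotProduct, Fin.sum_univ_two]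
  refine ⟨g, fun u w => ?_, ?_, ?_⟩
  · rw [hg, hg']
    simp [mul_right_comm _ u, hdC]
  · rw [h01]
    exact mul_ne_zero hdC hq
  · rw [h10, h01, map_mul, Complex.conj_ofReal, ← div_eq_mul_inv, div_eq_iff hdC]
    apply mul_left_cancel₀ hq
    linear_combination hB + hd2

/-- If `a₁ = tr A₁`, `a₂ = tr A₂` are real in `(-2,2)`, `v₁ = tr(A₁A₂)` is real
with `a₁² + a₂² + v₁² − a₁a₂v₁ − 4 < 0` (so `v₁` lies in the open interior of
`I_{a₁,a₂}`), and the remaining trace coordinates `tr A₃, tr A₄, tr(A₂A₃),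
tr(A₁A₃)` are real, then the quadruple is an SU(2)-class. -/
theorem real_traces_strict_interior_su2
    (A1 A2 A3 A4 : Matrix (Fin 2) (Fin 2) ℂ)
    (h1 : A1.det = 1) (h2 : A2.det = 1) (h3 : A3.det = 1) (h4 : A4.det = 1)
    (hprod : A1 * A2 * A3 * A4 = 1)
    (ht1 : A1.trace.im = 0) (ht2 : A2.trace.im = 0)
    (ha1 : A1.trace.re ∈ Set.Ioo (-2 : ℝ) 2) (ha2 : A2.trace.re ∈ Set.Ioo (-2 : ℝ) 2)
    (hv1 : (A1 * A2).trace.im = 0)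
    (hint : A1.trace.re ^ 2 + A2.trace.re ^ 2 + (A1 * A2).trace.re ^ 2
      - A1.trace.re * A2.trace.re * (A1 * A2).trace.re - 4 < 0)
    (ht3 : A3.trace.im = 0) (ht4 : A4.trace.im = 0)
    (hv2 : (A2 * A3).trace.im = 0) (hv3 : (A1 * A3).trace.im = 0) :
    IsSU2Class A1 A2 A3 A4 := by
  set a1 := A1.trace.re with ha1_def
  have ha1sq : 0 < 4 - a1 ^ 2 := by nlinarith [ha1.1, ha1.2]
  let u : ℂ := ⟨a1 / 2, √(4 - a1 ^ 2) / 2⟩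
  have hu_re : u.re = a1 / 2 := rfl
  have hu_pos : 0 < u.im := half_pos (Real.sqrt_pos.mpr ha1sq)
  have hu : u.im ≠ 0 := hu_pos.ne'
  have hu_sq : u.re ^ 2 + u.im ^ 2 = 1 := by
    change (a1 / 2) ^ 2 + (√(4 - a1 ^ 2) / 2) ^ 2 = 1
    rw [div_pow, div_pow, Real.sq_sqrt ha1sq.le]
    ring
  have hnorm : u * conj u = 1 := by
    rw [Complex.mul_conj, Complex.normSq_apply, ← sq, ← sq, hu_sq, Complex.ofReal_one]
  have huu : u ≠ conj u := fun h => hu (Complex.conj_eq_iff_im.mp h.symm)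
  have htr1 : A1.trace = u + conj u := by
    apply Complex.ext
    · rw [Complex.add_re, Complex.conj_re, hu_re, ← ha1_def]
      ring
    · simp [ht1]
  clear_value u
  obtain ⟨g, hg⟩ := exists_conj_eq_diagonal_s8 huu htr1 (h1.trans hnorm.symm)
  apply IsSU2Class.of_conj g
  rw [← det_conj_GL g] at h2 h3
  rw [← trace_conj_GL g] at ht2 ht3 ht4 hv1 hv2 hv3
  rw [← trace_conj_GL g A2, ← trace_conj_GL g (A1 * A2)] at hint
  have hprod' : g.1 * A1 * (g⁻¹).1 * (g.1 * A2 * (g⁻¹).1) * (g.1 * A3 * (g⁻¹).1)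
      * (g.1 * A4 * (g⁻¹).1) = 1 := by
    rw [conj_GL_mul, conj_GL_mul, conj_GL_mul, hprod, Matrix.mul_one, Units.mul_inv]
  rw [← conj_GL_mul] at hv1 hv2 hv3 hint
  rw [hg] at hv1 hv3 hint hprod' ⊢
  generalize g.1 * A2 * (g⁻¹).1 = B2 at *
  generalize g.1 * A3 * (g⁻¹).1 = B3 at *
  generalize g.1 * A4 * (g⁻¹).1 = B4 at *
  have hdiag := diag_conj_of_traces_real hu ht2 hv1
  have hoff : B2 0 1 * B2 1 0 = -((1 - Complex.normSq (B2 0 0) : ℝ) : ℂ) := by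
    rw [Matrix.det_fin_two, hdiag, Complex.mul_conj] at h2
    push_cast
    linear_combination -h2
  have hlt : 0 < 1 - Complex.normSq (B2 0 0) := by
    have ha1u : a1 = 2 * u.re := by rw [hu_re]; ring
    rw [ha1u] at hint
    simp [Matrix.trace_fin_two, Matrix.vecMul, dotProduct, Fin.sum_univ_two, hdiag] at hint
    rw [Complex.normSq_apply]
    have key : 0 < 4 * u.im ^ 2 * (1 - ((B2 0 0).re * (B2 0 0).re
        + (B2 0 0).im * (B2 0 0).im)) := by
      linear_combination hint - (4 - 4 * (B2 0 0).re ^ 2) * hu_sq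
    exact pos_of_mul_pos_right key (by positivity)
  obtain ⟨k, hk, hne, hanti⟩ := exists_diagonal_conj hlt hoff
  have hk11 : (k.1 * B2 * (k⁻¹).1) 1 1 = conj ((k.1 * B2 * (k⁻¹).1) 0 0) := by
    rw [← trace_conj_GL k] at ht2 hv1
    rw [← conj_GL_mul, hk] at hv1
    exact diag_conj_of_traces_real hu ht2 hv1
  apply IsSU2Class.of_conj k
  rw [← det_conj_GL k] at h2 h3
  rw [← trace_conj_GL k] at ht3 ht4 hv2 hv3
  rw [← conj_GL_mul] at hv2 hv3
  rw [hk] at hv3 ⊢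
  refine isSU2Class_of_normal_form hu hnorm h2 h3 ?_ hk11 hanti hne ht3 ht4 hv2 hv3
  rw [← hk u (conj u), conj_GL_mul, conj_GL_mul, conj_GL_mul, hprod', Matrix.mul_one,
    Units.mul_inv]
end

section
/- Let a₁, a₂ ∈ ℂ with a₁ ∉ {0, 2, −2} and a₂ ∉ {0, 2, −2}, and set a = (a₁, a₂, a₂, −a₁). Then the set of v ∈ ℂ³ satisfying f(a,v) = 0, τ₂(v) = v, τ₁(τ₁(v)) = v and τ₃(τ₃(v)) = v is exactly the two-element set {(0, 2 − a₁², 0), (0, a₂² − 2, 0)}. -/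
/-- For `a = (a₁, a₂, a₂, -a₁)` with `a₁, a₂ ∉ {0, 2, -2}`, the Δ-invariant
locus in the relative character variety is exactly the two points
`(0, 2 - a₁², 0)` and `(0, a₂² - 2, 0)`. -/
theorem delta_invariant_two_points (a1 a2 : ℂ)
    (h1 : a1 ≠ 0) (h2 : a1 ≠ 2) (h3 : a1 ≠ -2)
    (h4 : a2 ≠ 0) (h5 : a2 ≠ 2) (h6 : a2 ≠ -2) :
    {v : ℂ × ℂ × ℂ |
      fpoly a1 a2 a2 (-a1) v = 0 ∧
      tau2 a1 a2 a2 (-a1) v = v ∧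
      tau1 a1 a2 a2 (-a1) (tau1 a1 a2 a2 (-a1) v) = v ∧
      tau3 a1 a2 a2 (-a1) (tau3 a1 a2 a2 (-a1) v) = v} =
    {((0 : ℂ), (2 - a1 ^ 2 : ℂ), (0 : ℂ)), ((0 : ℂ), (a2 ^ 2 - 2 : ℂ), (0 : ℂ))} := by
  ext ⟨x, y, z⟩
  simp only [fpoly, tau1, tau2, tau3, Set.mem_ofPred_eq, Set.mem_insert_iff,
    Set.mem_singleton_iff, Prod.mk.injEq, true_and, and_true]
  constructor
  · rintro ⟨hf, ⟨hx, hz⟩, -, -⟩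
    have hx2 : 2 * x = -(y * z) := by linear_combination -hx
    have hz2 : 2 * z = -(x * y) := by linear_combination -hz - y * hx
    have hprod : x * ((y - 2) * (y + 2)) = 0 := by
      linear_combination -2 * hx2 + y * hz2
    rcases mul_eq_zero.1 hprod with rfl | hy
    · have hz0 : z = 0 := by linear_combination hz2 / 2
      subst hz0
      have hroots : (y - (2 - a1 ^ 2)) * (y - (a2 ^ 2 - 2)) = 0 := by
        linear_combination hf
      rcases mul_eq_zero.1 hroots with h | h
      · exact Or.inl ⟨rfl, sub_eq_zero.1 h, rfl⟩
      · exact Or.inr ⟨rfl, sub_eq_zero.1 h, rfl⟩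
    · exfalso
      rcases mul_eq_zero.1 hy with h | h
      · obtain rfl : y = 2 := sub_eq_zero.1 h
        obtain rfl : z = -x := by linear_combination hz2 / 2
        have hne : a1 * a1 * ((a2 - 2) * (a2 + 2)) ≠ 0 :=
          mul_ne_zero (mul_ne_zero h1 h1)
            (mul_ne_zero (sub_ne_zero.2 h5) (fun h => h6 (eq_neg_of_add_eq_zero_left h)))
        exact hne (by linear_combination -hf)
      · obtain rfl : y = -2 := eq_neg_of_add_eq_zero_left h
        obtain rfl : z = x := by linear_combination hz2 / 2
        have hne : a2 * a2 * ((a1 - 2) * (a1 + 2)) ≠ 0 :=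
          mul_ne_zero (mul_ne_zero h4 h4)
            (mul_ne_zero (sub_ne_zero.2 h2) (fun h => h3 (eq_neg_of_add_eq_zero_left h)))
        exact hne (by linear_combination -hf)
  · rintro (⟨rfl, rfl, rfl⟩ | ⟨rfl, rfl, rfl⟩) <;>
      refine ⟨?_, ⟨?_, ?_⟩, ⟨?_, ?_⟩, ⟨?_, ?_⟩⟩ <;> ring
end

section
/- Fix a = (1, −1, −1, −1). Then f(a, (0,1,0)) = 0 and f(a, (0,−1,0)) = 0; the map τ₂ fixes both points (0,1,0) and (0,−1,0); and each of τ₁ and τ₃ interchanges (0,1,0) and (0,−1,0). Consequently the orbit of (0,1,0) ∈ M_a under the group generated by τ₁, τ₂, τ₃ is exactly the two-element set {(0,1,0), (0,−1,0)}. -/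
theorem tau1_injective (a1 a2 a3 a4 : ℂ) : Function.Injective (tau1 a1 a2 a3 a4) := by
  rintro ⟨x, y, z⟩ ⟨x', y', z'⟩ h
  simp only [tau1, Prod.mk.injEq] at h ⊢
  obtain ⟨rfl, h2, h3⟩ := h
  have hy : y = y' := by linear_combination -h2 - x * h3
  subst hy
  exact ⟨rfl, rfl, by linear_combination -h3⟩

theorem tau2_injective (a1 a2 a3 a4 : ℂ) : Function.Injective (tau2 a1 a2 a3 a4) := by
  rintro ⟨x, y, z⟩ ⟨x', y', z'⟩ h
  simp only [tau2, Prod.mk.injEq] at h ⊢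
  obtain ⟨h1, rfl, h3⟩ := h
  have hz : z = z' := by linear_combination -h3 - y * h1
  subst hz
  exact ⟨by linear_combination -h1, rfl, rfl⟩

theorem tau3_injective (a1 a2 a3 a4 : ℂ) : Function.Injective (tau3 a1 a2 a3 a4) := by
  rintro ⟨x, y, z⟩ ⟨x', y', z'⟩ h
  simp only [tau3, Prod.mk.injEq] at h ⊢
  obtain ⟨h1, h2, rfl⟩ := h
  have hx : x = x' := by linear_combination -h1 - z * h2
  subst hx
  exact ⟨rfl, by linear_combination -h2, rfl⟩

/-- An injective map that permutes two points reflects membership in the pair. -/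
theorem mem_pair_of_map_mem_pair {α : Type*} {f : α → α} (hf : Function.Injective f) {p q : α}
    (h : f p = p ∧ f q = q ∨ f p = q ∧ f q = p) {x : α} (hx : f x ∈ ({p, q} : Set α)) :
    x ∈ ({p, q} : Set α) := by
  rcases h with ⟨hp, hq⟩ | ⟨hp, hq⟩ <;> rcases hx with hx | hx
  · exact Or.inl (hf (hx.trans hp.symm))
  · exact Or.inr (hf (hx.trans hq.symm))
  · exact Or.inr (hf (hx.trans hq.symm))
  · exact Or.inl (hf (hx.trans hp.symm))

/-- For `a = (1, -1, -1, -1)`: both `(0,1,0)` and `(0,-1,0)` lie on `M_a`;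
τ₂ fixes both; τ₁ and τ₃ interchange them; and the orbit of `(0,1,0)` under
the group generated by τ₁, τ₂, τ₃ (the smallest set containing `(0,1,0)`
closed under the generators and their inverses) is exactly
`{(0,1,0), (0,-1,0)}`. -/
theorem two_point_orbit :
    fpoly 1 (-1) (-1) (-1) ((0 : ℂ), (1 : ℂ), (0 : ℂ)) = 0 ∧
    fpoly 1 (-1) (-1) (-1) ((0 : ℂ), (-1 : ℂ), (0 : ℂ)) = 0 ∧
    tau2 1 (-1) (-1) (-1) ((0 : ℂ), (1 : ℂ), (0 : ℂ)) = ((0 : ℂ), (1 : ℂ), (0 : ℂ)) ∧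
    tau2 1 (-1) (-1) (-1) ((0 : ℂ), (-1 : ℂ), (0 : ℂ)) = ((0 : ℂ), (-1 : ℂ), (0 : ℂ)) ∧
    tau1 1 (-1) (-1) (-1) ((0 : ℂ), (1 : ℂ), (0 : ℂ)) = ((0 : ℂ), (-1 : ℂ), (0 : ℂ)) ∧
    tau1 1 (-1) (-1) (-1) ((0 : ℂ), (-1 : ℂ), (0 : ℂ)) = ((0 : ℂ), (1 : ℂ), (0 : ℂ)) ∧
    tau3 1 (-1) (-1) (-1) ((0 : ℂ), (1 : ℂ), (0 : ℂ)) = ((0 : ℂ), (-1 : ℂ), (0 : ℂ)) ∧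
    tau3 1 (-1) (-1) (-1) ((0 : ℂ), (-1 : ℂ), (0 : ℂ)) = ((0 : ℂ), (1 : ℂ), (0 : ℂ)) ∧
    ⋂₀ {S : Set (ℂ × ℂ × ℂ) |
          ((0 : ℂ), (1 : ℂ), (0 : ℂ)) ∈ S ∧
          (∀ x ∈ S, tau1 1 (-1) (-1) (-1) x ∈ S ∧
                    tau2 1 (-1) (-1) (-1) x ∈ S ∧
                    tau3 1 (-1) (-1) (-1) x ∈ S) ∧
          (∀ x, (tau1 1 (-1) (-1) (-1) x ∈ S → x ∈ S) ∧
                (tau2 1 (-1) (-1) (-1) x ∈ S → x ∈ S) ∧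
                (tau3 1 (-1) (-1) (-1) x ∈ S → x ∈ S))} =
      {((0 : ℂ), (1 : ℂ), (0 : ℂ)), ((0 : ℂ), (-1 : ℂ), (0 : ℂ))} := by
  have h2p : tau2 1 (-1) (-1) (-1) (0, 1, 0) = (0, 1, 0) := by simp [tau2]
  have h2q : tau2 1 (-1) (-1) (-1) (0, -1, 0) = (0, -1, 0) := by simp [tau2]
  have h1p : tau1 1 (-1) (-1) (-1) (0, 1, 0) = (0, -1, 0) := by simp [tau1]
  have h1q : tau1 1 (-1) (-1) (-1) (0, -1, 0) = (0, 1, 0) := by simp [tau1]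
  have h3p : tau3 1 (-1) (-1) (-1) (0, 1, 0) = (0, -1, 0) := by simp [tau3]
  have h3q : tau3 1 (-1) (-1) (-1) (0, -1, 0) = (0, 1, 0) := by simp [tau3]
  refine ⟨by norm_num [fpoly], by norm_num [fpoly], h2p, h2q, h1p, h1q, h3p, h3q,
    Set.Subset.antisymm (Set.sInter_subset_of_mem ⟨Or.inl rfl, ?_, fun x => ⟨?_, ?_, ?_⟩⟩) ?_⟩
  · rintro x (rfl | rfl)
    · rw [h1p, h2p, h3p]
      exact ⟨Or.inr rfl, Or.inl rfl, Or.inr rfl⟩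
    · rw [h1q, h2q, h3q]
      exact ⟨Or.inl rfl, Or.inr rfl, Or.inl rfl⟩
  · exact mem_pair_of_map_mem_pair (tau1_injective _ _ _ _) (Or.inr ⟨h1p, h1q⟩)
  · exact mem_pair_of_map_mem_pair (tau2_injective _ _ _ _) (Or.inl ⟨h2p, h2q⟩)
  · exact mem_pair_of_map_mem_pair (tau3_injective _ _ _ _) (Or.inr ⟨h3p, h3q⟩)
  · rintro x (rfl | rfl) S ⟨hp, hS, -⟩
    · exact hp
    · exact h1p ▸ (hS _ hp).1
end

section
/- Let a₁, a₂ be real numbers with a₁² + a₂² < 4. Let A = (A₁,A₂,A₃,A₄) be a quadruple of matrices in SL(2,ℂ) with A₁A₂A₃A₄ = I whose trace coordinates are (tr A₁, tr A₂, tr A₃, tr A₄) = (a₁, a₂, a₂, −a₁) and (tr(A₁A₂), tr(A₂A₃), tr(A₁A₃)) = (0, 2 − a₁², 0). Then A is an SU(2)-class, i.e. there exists g ∈ GL(2,ℂ) with g Aᵢ g⁻¹ ∈ SU(2) for i = 1,…,4. -/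
open Matrix

/-- Traceless `2 × 2` matrices satisfy `X * Y + Y * X = tr (X * Y)`. -/
lemma mul_add_mul_eq_trace_smul_one {R : Type*} [CommRing R] {X Y : Matrix (Fin 2) (Fin 2) R}
    (hX : X.trace = 0) (hY : Y.trace = 0) :
    X * Y + Y * X = (X * Y).trace • (1 : Matrix (Fin 2) (Fin 2) R) := by
  rw [trace_fin_two] at hX hY
  have hX' : X 1 1 = -X 0 0 := by linear_combination hX
  have hY' : Y 1 1 = -Y 0 0 := by linear_combination hY
  ext i j
  fin_cases i <;> fin_cases j <;>
    simp [Matrix.mul_apply, Fin.sum_univ_two, trace_fin_two, hX', hY'] <;> ring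

/-- A traceless matrix with `tr (X * X) = -2` is a square root of `-1`. -/
lemma mul_self_eq_neg_one {X : Matrix (Fin 2) (Fin 2) ℂ}
    (hX : X.trace = 0) (hXX : (X * X).trace = -2) : X * X = -1 := by
  have h := mul_add_mul_eq_trace_smul_one hX hX
  rw [hXX] at h
  ext i j
  have hij := congrFun (congrFun h i) j
  simp only [Matrix.add_apply, Matrix.smul_apply, smul_eq_mul, Matrix.neg_apply] at hij ⊢
  linear_combination hij / 2

/-- Every pair of anticommuting square roots of `-1` in `M₂(ℂ)` is conjugate to the standard
pair of quaternion units. -/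
lemma exists_conj_quaternion_units {X Y : Matrix (Fin 2) (Fin 2) ℂ}
    (hX : X.trace = 0) (hXX : X * X = -1) (hYY : Y * Y = -1) (hXY : X * Y = -(Y * X)) :
    ∃ P : GL (Fin 2) ℂ,
      X * (P : Matrix (Fin 2) (Fin 2) ℂ)
        = (P : Matrix (Fin 2) (Fin 2) ℂ) * !![Complex.I, 0; 0, -Complex.I] ∧
      Y * (P : Matrix (Fin 2) (Fin 2) ℂ)
        = (P : Matrix (Fin 2) (Fin 2) ℂ) * !![0, 1; -1, 0] := by
  have hne : X + Complex.I • (1 : Matrix (Fin 2) (Fin 2) ℂ) ≠ 0 := by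
    intro h
    have := congrArg trace h
    simp [hX] at this
  obtain ⟨u, hu⟩ : ∃ u, (X + Complex.I • (1 : Matrix (Fin 2) (Fin 2) ℂ)) *ᵥ u ≠ 0 := by
    by_contra! h
    exact hne (Matrix.ext_of_mulVec_single fun i => by rw [h, zero_mulVec])
  set v := (X + Complex.I • (1 : Matrix (Fin 2) (Fin 2) ℂ)) *ᵥ u with hv
  have hXv : X *ᵥ v = Complex.I • v := by
    rw [hv, mulVec_mulVec, mul_add, hXX, ← smul_mulVec]
    congr 1
    simp [smul_smul, add_comm]
  set w := -(Y *ᵥ v) with hw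
  have hYw : Y *ᵥ w = v := by
    rw [hw, mulVec_neg, mulVec_mulVec, hYY, neg_mulVec, one_mulVec, neg_neg]
  have hYv : Y *ᵥ v = -w := by rw [hw, neg_neg]
  have hXw : X *ᵥ w = -Complex.I • w := by
    rw [hw, mulVec_neg, mulVec_mulVec, hXY, neg_mulVec, ← mulVec_mulVec, hXv, mulVec_smul,
      smul_neg, neg_smul, neg_neg]
  set Q : Matrix (Fin 2) (Fin 2) ℂ := !![v 0, w 0; v 1, w 1] with hQ
  have hXQ : X * Q = Q * !![Complex.I, 0; 0, -Complex.I] := by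
    ext i j
    have e1 := congrFun hXv i
    have e2 := congrFun hXw i
    fin_cases i <;> fin_cases j <;>
      simp [hQ, Matrix.mul_apply, Fin.sum_univ_two, mulVec, dotProduct] at e1 e2 ⊢ <;>
      first | linear_combination e1 | linear_combination e2
  have hYQ : Y * Q = Q * !![0, 1; -1, 0] := by
    ext i j
    have e1 := congrFun hYv i
    have e2 := congrFun hYw i
    fin_cases i <;> fin_cases j <;>
      simp [hQ, Matrix.mul_apply, Fin.sum_univ_two, mulVec, dotProduct] at e1 e2 ⊢ <;>
      first | linear_combination e1 | linear_combination e2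
  have hdet : Q.det ≠ 0 := by
    intro h0
    obtain ⟨x, hx, hQx⟩ := Matrix.exists_mulVec_eq_zero_iff.mpr h0
    have hlin : x 0 • v + x 1 • w = 0 := by
      ext i
      have := congrFun hQx i
      fin_cases i <;> simp [hQ, mulVec, dotProduct] at this ⊢ <;> linear_combination this
    have hlinX : x 0 • v - x 1 • w = 0 := by
      have h := congrArg (fun z => -Complex.I • (X *ᵥ z)) hlin
      simp only [mulVec_add, mulVec_smul, hXv, hXw, mulVec_zero, smul_zero] at h
      rw [← h]
      ext i
      simp only [Pi.sub_apply, Pi.smul_apply, Pi.add_apply, smul_eq_mul]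
      linear_combination (v i * x 0 - w i * x 1) * Complex.I_sq
    have hv0 : v ≠ 0 := hu
    have hw0 : w ≠ 0 := by
      intro h
      rw [h, mulVec_zero] at hYw
      exact hv0 hYw.symm
    have hx0 : x 0 • v = 0 := by
      ext i
      have e1 := congrFun hlin i
      have e2 := congrFun hlinX i
      simp at e1 e2 ⊢
      have : x 0 * v i = 0 := by linear_combination (e1 + e2) / 2
      simpa using this
    have hx1 : x 1 • w = 0 := by rwa [hx0, zero_add] at hlin
    apply hx
    ext i
    fin_cases i
    · exact (smul_eq_zero.mp hx0).resolve_right hv0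
    · exact (smul_eq_zero.mp hx1).resolve_right hw0
  exact ⟨GeneralLinearGroup.mkOfDetNeZero Q hdet, hXQ, hYQ⟩

/-- A determinant-one matrix with real coordinates in the quaternion basis is unitary. -/
lemma mem_unitaryGroup_of_real_traces {M : Matrix (Fin 2) (Fin 2) ℂ} (hdet : M.det = 1)
    (h1 : M.trace.im = 0)
    (hX : (M * !![Complex.I, 0; 0, -Complex.I]).trace.im = 0)
    (hY : (M * !![0, 1; -1, 0]).trace.im = 0)
    (hXY : (M * (!![Complex.I, 0; 0, -Complex.I] * !![0, 1; -1, 0])).trace.im = 0) :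
    M ∈ Matrix.unitaryGroup (Fin 2) ℂ := by
  have hstar : star M = M.adjugate := by
    simp [trace_fin_two, Matrix.mul_apply, Fin.sum_univ_two] at h1 hX hY hXY
    rw [adjugate_fin_two]
    ext i j
    fin_cases i <;> fin_cases j <;> apply Complex.ext <;> simp <;> linarith
  rw [mem_unitaryGroup_iff, hstar, mul_adjugate, hdet, one_smul]

/-- Anticommuting square roots `X`, `Y` of `-1` can be simultaneously conjugated so that every
determinant-one matrix with real coordinates in `1, X, Y, X * Y` becomes unitary. -/
lemma exists_conj_mem_unitaryGroup {X Y : Matrix (Fin 2) (Fin 2) ℂ}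
    (hX : X.trace = 0) (hXX : X * X = -1) (hYY : Y * Y = -1) (hXY : X * Y = -(Y * X)) :
    ∃ g : GL (Fin 2) ℂ, ∀ M : Matrix (Fin 2) (Fin 2) ℂ, M.det = 1 → M.trace.im = 0 →
      (M * X).trace.im = 0 → (M * Y).trace.im = 0 → (M * (X * Y)).trace.im = 0 →
      (g : Matrix (Fin 2) (Fin 2) ℂ) * M * ((g⁻¹ : GL (Fin 2) ℂ) : Matrix (Fin 2) (Fin 2) ℂ)
        ∈ Matrix.unitaryGroup (Fin 2) ℂ := by
  obtain ⟨P, hXP, hYP⟩ := exists_conj_quaternion_units hX hXX hYY hXY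
  have hinv : (P : Matrix (Fin 2) (Fin 2) ℂ) * (P⁻¹ : GL (Fin 2) ℂ) = 1 := P.mul_inv
  have htrace {M D Z : Matrix (Fin 2) (Fin 2) ℂ}
      (h : Z * (P : Matrix (Fin 2) (Fin 2) ℂ) = (P : Matrix (Fin 2) (Fin 2) ℂ) * D) :
      (((P⁻¹ : GL (Fin 2) ℂ) : Matrix (Fin 2) (Fin 2) ℂ) * M * P * D).trace = (M * Z).trace := by
    rw [mul_assoc, ← h, mul_assoc, trace_mul_comm]
    simp only [mul_assoc, hinv, mul_one]
  refine ⟨P⁻¹, fun M hdet h1 h2 h3 h4 => ?_⟩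
  rw [inv_inv]
  apply mem_unitaryGroup_of_real_traces
  · rw [det_mul, det_mul, hdet, mul_one, ← det_mul]
    exact (congrArg det P.inv_mul).trans det_one
  · simpa using (congrArg Complex.im (htrace (M := M) (Z := 1) (D := 1) (by simp))).trans
      (by simpa using h1)
  · rwa [htrace hXP]
  · rwa [htrace hYP]
  · rwa [htrace (Z := X * Y)]
    rw [mul_assoc, hYP, ← mul_assoc, hXP, mul_assoc]

/-- The trace of the square of a `2 × 2` matrix. -/
lemma trace_mul_self_fin_two {R : Type*} [CommRing R] (A : Matrix (Fin 2) (Fin 2) R) :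
    (A * A).trace = A.trace ^ 2 - 2 * A.det := by
  simp [trace_fin_two, det_fin_two, Matrix.mul_apply, Fin.sum_univ_two]
  ring

/-- A quadruple in SL(2,ℂ) with product the identity whose trace coordinates
are `(a₁, a₂, a₂, -a₁)` and `(0, 2 - a₁², 0)` with `a₁, a₂` real and
`a₁² + a₂² < 4` is an SU(2)-class. -/
theorem example_family_su2_class (a1 a2 : ℝ) (hlt : a1 ^ 2 + a2 ^ 2 < 4)
    (A1 A2 A3 A4 : Matrix (Fin 2) (Fin 2) ℂ)
    (h1 : A1.det = 1) (h2 : A2.det = 1) (h3 : A3.det = 1) (h4 : A4.det = 1)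
    (hprod : A1 * A2 * A3 * A4 = 1)
    (ht1 : A1.trace = (a1 : ℂ)) (ht2 : A2.trace = (a2 : ℂ))
    (ht3 : A3.trace = (a2 : ℂ)) (ht4 : A4.trace = (-a1 : ℂ))
    (hv1 : (A1 * A2).trace = 0) (hv2 : (A2 * A3).trace = (2 - a1 ^ 2 : ℂ))
    (hv3 : (A1 * A3).trace = 0) :
    IsSU2Class A1 A2 A3 A4 := by
  have hp : 0 < 1 - a1 ^ 2 / 4 := by nlinarith [sq_nonneg a2]
  set p := 1 - a1 ^ 2 / 4 with hp_def
  set c := a1 * a2 / (4 * p) with hc_def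
  have hcp : c * (4 * p) = a1 * a2 := by rw [hc_def]; field_simp
  have hq : 0 < 1 - a2 ^ 2 / 4 - c ^ 2 * p := by
    have h : p * (1 - a2 ^ 2 / 4 - c ^ 2 * p) = 1 - a1 ^ 2 / 4 - a2 ^ 2 / 4 := by
      linear_combination (1 - a2 ^ 2 / 4) * hp_def - (c * (4 * p) + a1 * a2) / 16 * hcp
    exact pos_of_mul_pos_right (by rw [h]; linarith) hp.le
  set q := 1 - a2 ^ 2 / 4 - c ^ 2 * p with hq_def
  obtain ⟨s, hs0, hs⟩ : ∃ s : ℝ, s ≠ 0 ∧ s ^ 2 = p :=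
    ⟨√p, (Real.sqrt_pos.mpr hp).ne', Real.sq_sqrt hp.le⟩
  obtain ⟨t, ht0, ht⟩ : ∃ t : ℝ, t ≠ 0 ∧ t ^ 2 = q :=
    ⟨√q, (Real.sqrt_pos.mpr hq).ne', Real.sq_sqrt hq.le⟩
  have hs0' : (s : ℂ) ≠ 0 := by exact_mod_cast hs0
  have ht0' : (t : ℂ) ≠ 0 := by exact_mod_cast ht0
  have hsC : (s : ℂ) ^ 2 = 1 - (a1 : ℂ) ^ 2 / 4 := by
    rw [hp_def] at hs; exact_mod_cast hs
  have htC : (t : ℂ) ^ 2 = 1 - (a2 : ℂ) ^ 2 / 4 - (c : ℂ) ^ 2 * (s : ℂ) ^ 2 := by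
    rw [hq_def, ← hs] at ht; exact_mod_cast ht
  have hcC : (c : ℂ) * (4 * (s : ℂ) ^ 2) = a1 * a2 := by
    rw [← hs] at hcp; exact_mod_cast hcp
  obtain ⟨X, hA1⟩ : ∃ X : Matrix (Fin 2) (Fin 2) ℂ,
      A1 = ((a1 / 2 : ℝ) : ℂ) • (1 : Matrix (Fin 2) (Fin 2) ℂ) + (s : ℂ) • X :=
    ⟨(s : ℂ)⁻¹ • (A1 - ((a1 / 2 : ℝ) : ℂ) • (1 : Matrix (Fin 2) (Fin 2) ℂ)), by
      rw [smul_inv_smul₀ hs0']; abel⟩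
  obtain ⟨Y, hA2⟩ : ∃ Y : Matrix (Fin 2) (Fin 2) ℂ,
      A2 = ((a2 / 2 : ℝ) : ℂ) • (1 : Matrix (Fin 2) (Fin 2) ℂ) + ((c * s : ℝ) : ℂ) • X
        + (t : ℂ) • Y :=
    ⟨(t : ℂ)⁻¹ • (A2 - (((a2 / 2 : ℝ) : ℂ) • (1 : Matrix (Fin 2) (Fin 2) ℂ)
      + ((c * s : ℝ) : ℂ) • X)), by
      rw [smul_inv_smul₀ ht0']; abel⟩
  have hX : X.trace = 0 := by
    rw [hA1] at ht1
    simp at ht1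
    exact ht1.resolve_left hs0
  have hY : Y.trace = 0 := by
    rw [hA2] at ht2
    simp [hX] at ht2
    exact ht2.resolve_left ht0
  have hXX : (X * X).trace = -2 := by
    have h := trace_mul_self_fin_two A1
    rw [h1, ht1, hA1] at h
    simp [add_mul, mul_add, hX] at h
    apply mul_left_cancel₀ (pow_ne_zero 2 hs0')
    linear_combination h + 2 * hsC
  have hXY : (X * Y).trace = 0 := by
    rw [hA1, hA2] at hv1
    simp [add_mul, mul_add, hX, hY, hXX] at hv1
    apply mul_left_cancel₀ (mul_ne_zero hs0' ht0')
    linear_combination hv1 + hcC / 2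
  have hYY : (Y * Y).trace = -2 := by
    have h := trace_mul_self_fin_two A2
    rw [h2, ht2, hA2] at h
    simp [add_mul, mul_add, hX, hY, hXX, hXY, trace_mul_comm Y X] at h
    apply mul_left_cancel₀ (pow_ne_zero 2 ht0')
    linear_combination h + 2 * htC
  have hXX' := mul_self_eq_neg_one hX hXX
  have hYY' := mul_self_eq_neg_one hY hYY
  have hXY' : X * Y = -(Y * X) := by
    have h := mul_add_mul_eq_trace_smul_one hX hY
    rw [hXY, zero_smul] at h
    exact eq_neg_of_add_eq_zero_left h
  have hXXY : X * (X * Y) = -Y := by rw [← mul_assoc, hXX', neg_one_mul]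
  have hYXY : Y * (X * Y) = X := by
    rw [hXY', mul_neg, ← mul_assoc, hYY', neg_one_mul, neg_neg]
  have hA3X : (s : ℂ) * (A3 * X).trace = ((-(a1 * a2 / 2) : ℝ) : ℂ) := by
    rw [hA1, trace_mul_comm] at hv3
    simp [mul_add, ht3] at hv3
    push_cast
    linear_combination hv3
  have hA3Y : (t : ℂ) * (A3 * Y).trace
      = ((2 - a1 ^ 2 - a2 ^ 2 / 2 + c * (a1 * a2 / 2) : ℝ) : ℂ) := by
    rw [hA2, trace_mul_comm] at hv2
    simp [mul_add, ht3] at hv2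
    push_cast at hA3X ⊢
    linear_combination hv2 - c * hA3X
  have hA123 : (A1 * A2 * A3).trace = -(a1 : ℂ) := by
    have h : A1 * A2 * A3 = A4.adjugate := by
      have := congrArg (· * A4.adjugate) hprod
      simpa [mul_assoc, mul_adjugate, h4] using this
    rw [h, ← ht4, adjugate_fin_two]
    simp [trace_fin_two, add_comm]
  obtain ⟨r, hA3XY⟩ : ∃ r : ℝ, ((s * t : ℝ) : ℂ) * (A3 * (X * Y)).trace = r := by
    rw [trace_mul_comm, hA1, hA2] at hA123
    simp [mul_add, add_mul, ht3, hXX'] at hA123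
    refine ⟨-a1 - a1 / 2 * (a2 / 2 * a2 + c * (-(a1 * a2 / 2))
      + (2 - a1 ^ 2 - a2 ^ 2 / 2 + c * (a1 * a2 / 2)))
      - (a2 / 2 * (-(a1 * a2 / 2)) - s * (c * s) * a2), ?_⟩
    push_cast at hA3X hA3Y ⊢
    linear_combination hA123 - (a1 / 2 * c + a2 / 2) * hA3X - a1 / 2 * hA3Y
  have him {x r : ℝ} {z : ℂ} (hx : x ≠ 0) (h : (x : ℂ) * z = r) : z.im = 0 := by
    have := congrArg Complex.im h
    rw [Complex.im_ofReal_mul, Complex.ofReal_im] at this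
    exact (mul_eq_zero.mp this).resolve_left hx
  obtain ⟨g, hg⟩ := exists_conj_mem_unitaryGroup hX hXX' hYY' hXY'
  have hU1 := hg A1 h1 (by simp [ht1])
    (by rw [hA1]; simp [add_mul, hX, hXX'])
    (by rw [hA1]; simp [add_mul, hY, hXY])
    (by rw [hA1]; simp [add_mul, hXY, hXXY, hY])
  have hU2 := hg A2 h2 (by simp [ht2])
    (by rw [hA2]; simp [add_mul, hX, hXX', trace_mul_comm Y X, hXY])
    (by rw [hA2]; simp [add_mul, hY, hXY, hYY'])
    (by rw [hA2]; simp [add_mul, hXY, hXXY, hY, hYXY, hX])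
  have hU3 := hg A3 h3 (by simp [ht3]) (him hs0 hA3X) (him ht0 hA3Y)
    (him (mul_ne_zero hs0 ht0) hA3XY)
  have hginv : ((g⁻¹ : GL (Fin 2) ℂ) : Matrix (Fin 2) (Fin 2) ℂ) * g = 1 := g.inv_mul
  have hginv' : (g : Matrix (Fin 2) (Fin 2) ℂ) * (g⁻¹ : GL (Fin 2) ℂ) = 1 := g.mul_inv
  have hconj (M N : Matrix (Fin 2) (Fin 2) ℂ) :
      (g : Matrix (Fin 2) (Fin 2) ℂ) * M * (g⁻¹ : GL (Fin 2) ℂ) * (g * N * (g⁻¹ : GL (Fin 2) ℂ))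
        = g * (M * N) * (g⁻¹ : GL (Fin 2) ℂ) := by
    calc _ = (g : Matrix (Fin 2) (Fin 2) ℂ) * M * ((g⁻¹ : GL (Fin 2) ℂ) * g) * N
          * (g⁻¹ : GL (Fin 2) ℂ) := by simp only [mul_assoc]
      _ = _ := by rw [hginv]; simp only [mul_assoc, one_mul]
  have hdet (M : Matrix (Fin 2) (Fin 2) ℂ) (hM : M.det = 1) :
      ((g : Matrix (Fin 2) (Fin 2) ℂ) * M * (g⁻¹ : GL (Fin 2) ℂ)).det = 1 := by
    rw [det_mul, det_mul, hM, mul_one, ← det_mul, hginv', det_one]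
  have hU4 : (g : Matrix (Fin 2) (Fin 2) ℂ) * A4 * (g⁻¹ : GL (Fin 2) ℂ)
      ∈ Matrix.unitaryGroup (Fin 2) ℂ := by
    have hU := mul_mem (mul_mem hU1 hU2) hU3
    rw [hconj, hconj] at hU
    have h := hconj (A1 * A2 * A3) A4
    rw [hprod, mul_one, hginv'] at h
    have hstar := left_inv_eq_right_inv (mem_unitaryGroup_iff'.mp hU) h
    rw [← hstar]
    exact Unitary.star_mem hU
  refine ⟨g, fun B hB => ?_⟩
  rcases hB with rfl | rfl | rfl | rfl
  · exact ⟨hU1, hdet _ h1⟩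
  · exact ⟨hU2, hdet _ h2⟩
  · exact ⟨hU3, hdet _ h3⟩
  · exact ⟨hU4, hdet _ h4⟩
end
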